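/- arXiv:1903.08223 — 14 statements merged into one kernel-verified Lean document; each statement's English description precedes it below -/
import Mathlib

section
/- Let T be a Hermitian n×n complex matrix and Θ an n×m complex matrix. Then the kernel of Θᴴ contains no eigenvector of T if and only if the Kalman space V(T,Θ) is all of ℂ^n. -/
open Matrix

/-- The Kalman space `V(T, Θ)`: the `ℂ`-linear span of the columns of the matrices
`T ^ k * Θ` for all `k : ℕ`. -/
noncomputable def kalmanSpace {n m : Type*} [Fintype n] [Fintype m] [DecidableEq n]
    (T : Matrix n n ℂ) (Θ : Matrix n m ℂ) : Submodule ℂ (n → ℂ) :=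
  Submodule.span ℂ {v | ∃ (k : ℕ) (x : m → ℂ), v = (T ^ k * Θ).mulVec x}

theorem kalman_aux {n m : ℕ}
    (T : Matrix (Fin n) (Fin n) ℂ) (hT : T.IsHermitian)
    (Θ : Matrix (Fin n) (Fin m) ℂ) (u : Fin n → ℂ) (k : ℕ) (x : Fin m → ℂ) :
    star u ⬝ᵥ ((T ^ k * Θ).mulVec x) = star (Θᴴ.mulVec ((T ^ k).mulVec u)) ⬝ᵥ x := by
  rw [Matrix.dotProduct_mulVec, Matrix.star_mulVec, Matrix.star_mulVec,
    Matrix.conjTranspose_conjTranspose, Matrix.conjTranspose_pow, hT.eq, Matrix.vecMul_vecMul]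

/-- For a Hermitian matrix `T`, the kernel of `Θᴴ` contains no eigenvector of `T` iff the
Kalman space `V(T, Θ)` is all of `ℂ^n`. -/
theorem kernel_no_eigenvector_iff_kalman_top {n m : ℕ}
    (T : Matrix (Fin n) (Fin n) ℂ) (hT : T.IsHermitian)
    (Θ : Matrix (Fin n) (Fin m) ℂ) :
    (¬ ∃ (u : Fin n → ℂ) (μ : ℂ), u ≠ 0 ∧ T.mulVec u = μ • u ∧ Θᴴ.mulVec u = 0) ↔
      kalmanSpace T Θ = ⊤ := by
  constructor
  · intro h
    by_contra hne
    apply h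
    obtain ⟨f, hf, hle⟩ := Submodule.exists_le_ker_of_lt_top _ (lt_top_iff_ne_top.mpr hne)
    let W : Submodule ℂ (Fin n → ℂ) :=
      ⨅ k : ℕ, LinearMap.ker ((Θᴴ * T ^ k).mulVecLin)
    have hW : ∀ w, w ∈ W ↔ ∀ k : ℕ, Θᴴ.mulVec ((T ^ k).mulVec w) = 0 := by
      intro w
      simp [W, Submodule.mem_iInf]
    have hinv : ∀ w ∈ W, T.mulVecLin w ∈ W := by
      intro w hw
      rw [hW] at hw ⊢
      intro k
      have := hw (k + 1)
      rw [pow_succ, ← Matrix.mulVec_mulVec] at this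
      simpa using this
    let w : Fin n → ℂ := fun i => f (Pi.single i 1)
    have hfw : ∀ v, f v = w ⬝ᵥ v := by
      intro v
      rw [LinearMap.pi_apply_eq_sum_univ f v]
      simp only [dotProduct, w, smul_eq_mul]
      refine Finset.sum_congr rfl fun i _ => ?_
      rw [mul_comm]
      congr 2
      ext j
      simp [Pi.single_apply, eq_comm]
    have hw0 : star w ≠ 0 := by
      intro h0
      apply hf
      ext v
      simp [hfw, star_eq_zero.mp h0]
    have hwW : star w ∈ W := by
      rw [hW]
      intro k
      have key : ∀ x, star (Θᴴ.mulVec ((T ^ k).mulVec (star w))) ⬝ᵥ x = 0 := by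
        intro x
        rw [← kalman_aux T hT, star_star, ← hfw]
        exact hle (Submodule.subset_span ⟨k, x, rfl⟩)
      exact star_eq_zero.mp (dotProduct_eq_zero _ key)
    have : Nontrivial W := ⟨⟨⟨star w, hwW⟩, 0, fun h => hw0 (congrArg Subtype.val h)⟩⟩
    obtain ⟨μ, hμ⟩ := Module.End.exists_eigenvalue (T.mulVecLin.restrict hinv)
    obtain ⟨u, hu⟩ := hμ.exists_hasEigenvector
    refine ⟨u, μ, fun h => hu.2 (Subtype.ext h), ?_, ?_⟩
    · simpa using congrArg Subtype.val hu.apply_eq_smul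
    · simpa using (hW u).mp u.2 0
  · rintro htop ⟨u, μ, hu0, hu, hΘ⟩
    have hk : ∀ k : ℕ, (T ^ k).mulVec u = μ ^ k • u := by
      intro k
      induction k with
      | zero => simp
      | succ k ih =>
        rw [pow_succ, ← Matrix.mulVec_mulVec, hu, Matrix.mulVec_smul, ih, smul_smul, pow_succ,
          mul_comm]
    have hall : ∀ v ∈ kalmanSpace T Θ, star u ⬝ᵥ v = 0 := by
      intro v hv
      unfold kalmanSpace at hv
      induction hv using Submodule.span_induction with
      | mem v hv =>
        obtain ⟨k, x, rfl⟩ := hv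
        rw [kalman_aux T hT, hk, Matrix.mulVec_smul, hΘ]
        simp
      | zero => simp
      | add a b _ _ ha hb => rw [dotProduct_add, ha, hb, add_zero]
      | smul c a _ ha => rw [dotProduct_smul, ha, smul_zero]
    have := hall u (by rw [htop]; trivial)
    open scoped ComplexOrder in
    exact hu0 (dotProduct_star_self_eq_zero.mp this)
end

section
/- Let T be a Hermitian n×n complex matrix, Θ an n×m complex matrix, and G = -i•T - (1/2)•(Θ*Θᴴ). If u is a nonzero vector with G.mulVec u = z • u for some z ∈ ℂ, then Re z = -‖Θᴴ.mulVec u‖² / (2‖u‖²) ≤ 0; moreover, if Re z = 0 then Θᴴ.mulVec u = 0 and T.mulVec u = (-Im z) • u, so u is an eigenvector of T lying in ker Θᴴ. -/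
open Matrix

/-- `star v ⬝ᵥ v` is the squared Euclidean norm. -/
lemma star_dot_self_aux {k : ℕ} (v : Fin k → ℂ) :
    star v ⬝ᵥ v = ((∑ i, ‖v i‖ ^ 2 : ℝ) : ℂ) := by
  simp only [dotProduct, Pi.star_apply, RCLike.star_def, Complex.conj_mul']
  push_cast
  rfl

/-- For `T` Hermitian and `G = -i•T - (1/2)•(Θ*Θᴴ)`, any eigenvalue `z` of `G` with
eigenvector `u` satisfies `Re z = -‖Θᴴ u‖² / (2‖u‖²) ≤ 0`, and if `Re z = 0` then
`Θᴴ u = 0` and `u` is an eigenvector of `T` for the eigenvalue `-Im z`. -/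
theorem eigenvalue_re_nonpos_of_dissipative {n m : ℕ}
    (T : Matrix (Fin n) (Fin n) ℂ) (hT : T.IsHermitian)
    (Θ : Matrix (Fin n) (Fin m) ℂ)
    (G : Matrix (Fin n) (Fin n) ℂ)
    (hG : G = (-Complex.I) • T - (1/2 : ℂ) • (Θ * Θᴴ))
    (u : Fin n → ℂ) (hu : u ≠ 0) (z : ℂ) (huz : G.mulVec u = z • u) :
    z.re = -(∑ j, ‖Θᴴ.mulVec u j‖ ^ 2) / (2 * ∑ i, ‖u i‖ ^ 2) ∧
    z.re ≤ 0 ∧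
    (z.re = 0 → Θᴴ.mulVec u = 0 ∧ T.mulVec u = (-z.im : ℂ) • u) := by
  have hS : 0 < ∑ i, ‖u i‖ ^ 2 := by
    obtain ⟨i, hi⟩ := Function.ne_iff.mp hu
    refine Finset.sum_pos' (fun _ _ => by positivity) ⟨i, Finset.mem_univ _, ?_⟩
    have : 0 < ‖u i‖ := norm_pos_iff.mpr hi
    positivity
  have hP0 : 0 ≤ ∑ j, ‖Θᴴ.mulVec u j‖ ^ 2 := Finset.sum_nonneg fun _ _ => by positivity
  have him : (star u ⬝ᵥ T *ᵥ u).im = 0 := hT.im_star_dotProduct_mulVec_self u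
  have hexp : (-Complex.I) • (T *ᵥ u) - (1/2 : ℂ) • (Θ *ᵥ (Θᴴ *ᵥ u)) = z • u := by
    rw [← huz, hG, sub_mulVec, smul_mulVec, smul_mulVec, mulVec_mulVec]
  have hP : star u ⬝ᵥ (Θ *ᵥ (Θᴴ *ᵥ u)) = ((∑ j, ‖Θᴴ.mulVec u j‖ ^ 2 : ℝ) : ℂ) := by
    rw [← star_dot_self_aux, dotProduct_mulVec, star_mulVec, conjTranspose_conjTranspose]
  have hkey := congrArg (fun w => (star u ⬝ᵥ w).re) hexp
  simp only [dotProduct_sub, dotProduct_smul, hP, star_dot_self_aux, smul_eq_mul] at hkey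
  generalize hSd : ∑ i, ‖u i‖ ^ 2 = S at *
  generalize hPd : ∑ j, ‖Θᴴ.mulVec u j‖ ^ 2 = P at *
  have hkey2 : z.re * S = -P / 2 := by
    have h2 : (1/2 : ℂ) = ((1/2 : ℝ) : ℂ) := by push_cast; rfl
    rw [h2, Complex.sub_re, Complex.re_ofReal_mul, Complex.re_mul_ofReal, Complex.mul_re,
      him, Complex.ofReal_re] at hkey
    simp at hkey
    linarith
  have hre : z.re = -P / (2 * S) := by
    field_simp
    linarith
  refine ⟨hre, ?_, fun h0 => ?_⟩
  · rw [hre]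
    exact div_nonpos_of_nonpos_of_nonneg (by linarith) (by linarith)
  · have hPz : P = 0 := by rw [h0] at hkey2; linarith
    have hv : Θᴴ *ᵥ u = 0 := by
      funext j
      rw [hPz, Finset.sum_eq_zero_iff_of_nonneg (fun _ _ => by positivity)] at hPd
      simpa using hPd j (Finset.mem_univ _)
    refine ⟨hv, ?_⟩
    rw [hv, mulVec_zero, smul_zero, sub_zero] at hexp
    have hz : z = z.im * Complex.I := by
      apply Complex.ext <;> simp [h0]
    have h3 := congrArg (fun w => Complex.I • w) hexp
    simp only [smul_smul] at h3
    have h4 : Complex.I * -Complex.I = 1 := by simp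
    have h5 : Complex.I * z = -z.im := by
      apply Complex.ext <;> simp [h0]
    rw [h4, h5, one_smul] at h3
    exact h3
end

section
/- Let T be a Hermitian n×n complex matrix, Θ an n×m complex matrix, and G = -i•T - (1/2)•(Θ*Θᴴ). Then every eigenvalue z of G satisfies Re z < 0 if and only if the kernel of Θᴴ contains no eigenvector of T. -/
open Matrix

/-- For `T` Hermitian and `G = -i•T - (1/2)•(Θ*Θᴴ)`, every eigenvalue of `G` has strictly
negative real part iff `ker Θᴴ` contains no eigenvector of `T`. -/
theorem all_eigenvalues_neg_re_iff_no_eigenvector_in_ker {n m : ℕ}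
    (T : Matrix (Fin n) (Fin n) ℂ) (hT : T.IsHermitian)
    (Θ : Matrix (Fin n) (Fin m) ℂ)
    (G : Matrix (Fin n) (Fin n) ℂ)
    (hG : G = (-Complex.I) • T - (1/2 : ℂ) • (Θ * Θᴴ)) :
    (∀ (z : ℂ) (u : Fin n → ℂ), u ≠ 0 → G.mulVec u = z • u → z.re < 0) ↔
      (¬ ∃ (u : Fin n → ℂ) (μ : ℂ), u ≠ 0 ∧ T.mulVec u = μ • u ∧ Θᴴ.mulVec u = 0) := by
  have hq : ∀ u : Fin n → ℂ, (star u ⬝ᵥ T.mulVec u).im = 0 := fun u =>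
    hT.im_star_dotProduct_mulVec_self u
  have hp : ∀ (k : ℕ) (u : Fin k → ℂ), u ≠ 0 →
      0 < (star u ⬝ᵥ u).re ∧ (star u ⬝ᵥ u).im = 0 := by
    intro k u hu
    open ComplexOrder in
    have h := Complex.lt_def.mp (Matrix.dotProduct_star_self_pos_iff.mpr hu)
    exact ⟨by simpa using h.1, by simpa using h.2.symm⟩
  have hGu : ∀ u : Fin n → ℂ, G.mulVec u =
      (-Complex.I) • T.mulVec u - (1/2 : ℂ) • Θ.mulVec (Θᴴ.mulVec u) := by
    intro u
    rw [hG, Matrix.sub_mulVec, Matrix.smul_mulVec, Matrix.smul_mulVec, Matrix.mulVec_mulVec]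
  constructor
  · rintro h ⟨u, μ, hu, hTu, hΘ⟩
    have h1 := h (-Complex.I * μ) u hu (by rw [hGu, hTu, hΘ]; simp [smul_smul])
    have h2 := hq u
    obtain ⟨h3, h4⟩ := hp n u hu
    rw [hTu, dotProduct_smul, smul_eq_mul, Complex.mul_im, h4] at h2
    have h5 : μ.im = 0 := by
      have : μ.im * (star u ⬝ᵥ u).re = 0 := by linarith
      exact (mul_eq_zero.mp this).resolve_right h3.ne'
    simp [h5] at h1
  · intro h z u hu hz
    by_contra hneg
    have hneg : 0 ≤ z.re := not_lt.mp hneg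
    have h2 := hq u
    obtain ⟨h3, h4⟩ := hp n u hu
    have hr : star u ⬝ᵥ Θ.mulVec (Θᴴ.mulVec u) = star (Θᴴ.mulVec u) ⬝ᵥ Θᴴ.mulVec u := by
      rw [Matrix.star_mulVec, conjTranspose_conjTranspose, Matrix.dotProduct_mulVec]
    have hΘ : Θᴴ.mulVec u = 0 := by
      by_contra hne
      obtain ⟨h5, h6⟩ := hp m _ hne
      have e := congrArg (fun v => (star u ⬝ᵥ v).re) hz
      simp only [hGu, dotProduct_sub, dotProduct_smul, hr, smul_eq_mul, Complex.sub_re,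
        Complex.mul_re, h4, h2, h6] at e
      norm_num at e
      nlinarith [mul_nonneg hneg h3.le]
    refine h ⟨u, Complex.I * z, hu, ?_, hΘ⟩
    rw [mul_smul, ← hz, hGu, hΘ]
    simp [smul_smul]
end

section
/- Let G be an n×n complex matrix and let 𝓛 be the linear endomorphism of Matrix (Fin n) (Fin n) ℂ given by 𝓛(R) = G*R + R*Gᴴ. Then z ∈ ℂ is an eigenvalue of 𝓛 if and only if z = λ + conj(μ) for some eigenvalues λ, μ of G; that is, the spectrum of 𝓛 equals {λ + conj(μ) : λ, μ ∈ spectrum(G)}. -/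
open Matrix

lemma exists_col_eigen {n : ℕ} (G R : Matrix (Fin n) (Fin n) ℂ) (a : ℂ) (hR : R ≠ 0)
    (h : G * R = a • R) : ∃ u : Fin n → ℂ, u ≠ 0 ∧ G.mulVec u = a • u := by
  by_contra hc
  push Not at hc
  apply hR
  ext i j
  by_contra hij
  refine hc (fun k => R k j) (fun h0 => hij (congrFun h0 i)) ?_
  ext k
  exact congrFun (congrFun h k) j

/-- The spectrum of the Lyapunov map `𝓛(R) = G*R + R*Gᴴ` on `n×n` complex matrices is
`{λ + conj μ : λ, μ eigenvalues of G}`. -/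
theorem lyapunov_map_eigenvalues {n : ℕ} (G : Matrix (Fin n) (Fin n) ℂ) (z : ℂ) :
    (∃ R : Matrix (Fin n) (Fin n) ℂ, R ≠ 0 ∧ G * R + R * Gᴴ = z • R) ↔
      ∃ lam mu : ℂ,
        (∃ u : Fin n → ℂ, u ≠ 0 ∧ G.mulVec u = lam • u) ∧
        (∃ v : Fin n → ℂ, v ≠ 0 ∧ G.mulVec v = mu • v) ∧
        z = lam + (starRingEnd ℂ) mu := by
  constructor
  · rintro ⟨R, hR, h⟩
    let E : Submodule ℂ (Matrix (Fin n) (Fin n) ℂ) :=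
      LinearMap.ker (LinearMap.mulLeft ℂ G + LinearMap.mulRight ℂ Gᴴ - z • LinearMap.id)
    have hE : ∀ S, S ∈ E ↔ G * S + S * Gᴴ = z • S := by
      intro S
      simp [E, sub_eq_zero]
    have hinv : ∀ S ∈ E, LinearMap.mulLeft ℂ G S ∈ E := by
      intro S hS
      rw [hE] at hS ⊢
      simp only [LinearMap.mulLeft_apply]
      rw [Matrix.mul_assoc G S, ← Matrix.mul_add, hS, Matrix.mul_smul]
    have : Nontrivial E := ⟨⟨⟨R, (hE R).2 h⟩, 0, fun h0 => hR (congrArg Subtype.val h0)⟩⟩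
    obtain ⟨a, ha⟩ := Module.End.exists_eigenvalue ((LinearMap.mulLeft ℂ G).restrict hinv)
    obtain ⟨S, hS⟩ := ha.exists_hasEigenvector
    have h1 : G * S.1 = a • S.1 := congrArg Subtype.val hS.apply_eq_smul
    have h0 : S.1 ≠ 0 := fun h => hS.2 (Subtype.ext h)
    have h2 := (hE S.1).1 S.2
    have h3 : S.1 * Gᴴ = (z - a) • S.1 := by
      rw [sub_smul, ← h2, h1]; abel
    have h4 : G * S.1ᴴ = star (z - a) • S.1ᴴ := by
      have := congrArg conjTranspose h3
      rwa [conjTranspose_mul, conjTranspose_conjTranspose, conjTranspose_smul] at this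
    refine ⟨a, star (z - a), exists_col_eigen G _ _ h0 h1,
      exists_col_eigen G _ _ (by simpa using h0) h4, ?_⟩
    simp
  · rintro ⟨a, b, ⟨u, hu, hGu⟩, ⟨v, hv, hGv⟩, rfl⟩
    refine ⟨vecMulVec u (star v), ?_, ?_⟩
    · obtain ⟨i, hi⟩ := Function.ne_iff.1 hu
      obtain ⟨j, hj⟩ := Function.ne_iff.1 hv
      intro h
      have := congrFun (congrFun h i) j
      simp [vecMulVec_apply] at this
      tauto
    · rw [mul_vecMulVec, vecMulVec_mul, ← star_mulVec, hGu, hGv]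
      ext i j
      simp [vecMulVec_apply]
      ring
end

section
/- Let G be an n×n complex matrix all of whose eigenvalues have strictly negative real part. Then for every n×n complex matrix C there exists a unique n×n complex matrix X such that G*X + X*Gᴴ + C = 0. -/
open Matrix

lemma eig_re_neg_aux {n : ℕ} (G : Matrix (Fin n) (Fin n) ℂ)
    (hG : ∀ (z : ℂ) (u : Fin n → ℂ), u ≠ 0 → G.mulVec u = z • u → z.re < 0)
    (X : Matrix (Fin n) (Fin n) ℂ) (hX : X ≠ 0) (z : ℂ) (h : G * X = z • X) : z.re < 0 := by
  obtain ⟨j, hj⟩ : ∃ j, X.col j ≠ 0 := by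
    by_contra! hc
    apply hX
    ext i j
    exact congrFun (hc j) i
  refine hG z _ hj ?_
  ext i
  exact congrFun (congrFun h i) j

/-- If all eigenvalues of `G` have strictly negative real part, then for every matrix `C`
the Lyapunov equation `G*X + X*Gᴴ + C = 0` has a unique solution. -/
theorem lyapunov_unique_solution {n : ℕ}
    (G : Matrix (Fin n) (Fin n) ℂ)
    (hG : ∀ (z : ℂ) (u : Fin n → ℂ), u ≠ 0 → G.mulVec u = z • u → z.re < 0)
    (C : Matrix (Fin n) (Fin n) ℂ) :
    ∃! X : Matrix (Fin n) (Fin n) ℂ, G * X + X * Gᴴ + C = 0 := by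
  let L : Matrix (Fin n) (Fin n) ℂ →ₗ[ℂ] Matrix (Fin n) (Fin n) ℂ :=
    LinearMap.mulLeft ℂ G + LinearMap.mulRight ℂ Gᴴ
  have hL : ∀ X, L X = G * X + X * Gᴴ := fun X => rfl
  have hker : LinearMap.ker L = ⊥ := by
    by_contra hne
    have hinv : ∀ X ∈ LinearMap.ker L, LinearMap.mulLeft ℂ G X ∈ LinearMap.ker L := by
      intro X hX
      rw [LinearMap.mem_ker, hL] at hX ⊢
      rw [LinearMap.mulLeft_apply, Matrix.mul_assoc, ← Matrix.mul_add, hX, Matrix.mul_zero]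
    haveI : Nontrivial (LinearMap.ker L) := Submodule.nontrivial_iff_ne_bot.mpr hne
    obtain ⟨z, hz⟩ := Module.End.exists_eigenvalue ((LinearMap.mulLeft ℂ G).restrict hinv)
    obtain ⟨⟨X, hXk⟩, hX⟩ := hz.exists_hasEigenvector
    have h1 : G * X = z • X := congrArg Subtype.val hX.apply_eq_smul
    have hX0 : X ≠ 0 := fun h => hX.2 (Subtype.ext h)
    rw [LinearMap.mem_ker, hL, h1] at hXk
    have h2 : X * Gᴴ = (-z) • X := by
      rw [neg_smul]; exact eq_neg_of_add_eq_zero_right hXk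
    have h3 : G * Xᴴ = (star (-z)) • Xᴴ := by
      rw [← Matrix.conjTranspose_smul, ← h2, Matrix.conjTranspose_mul,
        Matrix.conjTranspose_conjTranspose]
    have a := eig_re_neg_aux G hG X hX0 z h1
    have b := eig_re_neg_aux G hG Xᴴ (by simpa using hX0) _ h3
    simp at b
    linarith
  have hinj := LinearMap.ker_eq_bot.mp hker
  obtain ⟨X, hX⟩ := LinearMap.injective_iff_surjective.mp hinj (-C)
  refine ⟨X, ?_, ?_⟩
  · show G * X + X * Gᴴ + C = 0
    rw [← hL, hX, neg_add_cancel]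
  · intro Y hY
    apply hinj
    rw [hX, hL]
    exact eq_neg_of_add_eq_zero_left hY
end

section
/- Let T be a Hermitian n×n complex matrix, Θ an n×m complex matrix, and M_B an m×m complex matrix. The following are equivalent: (1) every solution M of the covariance master equation converges as t → +∞ (the limit may depend on the initial condition); (2) any two eigenvectors of T lying in ker Θᴴ have the same eigenvalue, i.e. if T.mulVec u = λ • u, T.mulVec v = μ • v with u, v nonzero and Θᴴ.mulVec u = Θᴴ.mulVec v = 0, then λ = μ; (3) the orthogonal complement of the Kalman space V(T,Θ) is contained in a single eigenspace of T. -/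
open Matrix Filter

attribute [local instance] Matrix.normedAddCommGroup Matrix.normedSpace

/-- The orthogonal complement of a subspace of `ℂ^n`, with respect to the standard
Hermitian inner product `⟪v, u⟫ = ∑ i, conj (v i) * u i`. -/
noncomputable def orthoComp {n : Type*} [Fintype n] (V : Submodule ℂ (n → ℂ)) :
    Submodule ℂ (n → ℂ) where
  carrier := {u | ∀ v ∈ V, star v ⬝ᵥ u = 0}
  add_mem' := by
    intro a b ha hb v hv
    simp [dotProduct_add, ha v hv, hb v hv]
  zero_mem' := by
    intro v hv
    simp
  smul_mem' := by
    intro c a ha v hv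
    simp [dotProduct_smul, ha v hv]

section
theorem ker_pow_aux {E : Type*} [AddCommGroup E] [Module ℂ E] (g : Module.End ℂ E)
    (h : ∀ x, g (g x) = 0 → g x = 0) : ∀ (k : ℕ) (x : E), (g ^ k) x = 0 → g x = 0 := by
  intro k
  induction k with
  | zero => intro x hx; simp at hx; simp [hx]
  | succ k ih =>
    intro x hx
    rw [pow_succ, Module.End.mul_apply] at hx
    exact h _ (ih _ hx)

/-- scalar coefficient -/
noncomputable def coefA (μ : ℂ) (j : ℕ) (t : ℝ) : ℂ :=
  Complex.exp (t * μ) * ((t : ℂ) ^ j / (j.factorial : ℂ))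

theorem coefA_deriv_zero (μ : ℂ) (t : ℝ) :
    HasDerivAt (coefA μ 0) (μ * coefA μ 0 t) t := by
  have h1 : HasDerivAt (fun t : ℝ => (t : ℂ) * μ) (1 * μ) t :=
    (Complex.ofRealCLM.hasDerivAt (x := t)).mul_const μ
  have h2 := h1.cexp
  have : coefA μ 0 = fun t : ℝ => Complex.exp (t * μ) := by
    funext s; simp [coefA]
  rw [this]
  convert h2 using 1
  ring

theorem coefA_deriv_succ (μ : ℂ) (j : ℕ) (t : ℝ) :
    HasDerivAt (coefA μ (j + 1)) (μ * coefA μ (j + 1) t + coefA μ j t) t := by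
  have h0 : HasDerivAt (fun t : ℝ => (t : ℂ)) 1 t := Complex.ofRealCLM.hasDerivAt (x := t)
  have h2 := (h0.mul_const μ).cexp
  have h3 := (h0.pow (j + 1)).div_const ((j + 1).factorial : ℂ)
  have h4 := h2.mul h3
  refine h4.congr_deriv ?_
  have hj : (j.factorial : ℂ) ≠ 0 := by exact_mod_cast j.factorial_ne_zero
  have hj1 : (j : ℂ) + 1 ≠ 0 := by exact_mod_cast j.succ_ne_zero
  simp only [coefA, Nat.factorial_succ]
  push_cast
  field_simp
  simp

theorem coefA_tendsto (μ : ℂ) (hμ : μ.re < 0) (j : ℕ) :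
    Tendsto (coefA μ j) atTop (nhds 0) := by
  rw [tendsto_zero_iff_norm_tendsto_zero]
  have h := tendsto_rpow_mul_exp_neg_mul_atTop_nhds_zero (j : ℝ) (-μ.re) (by linarith)
  have h2 := h.div_const (j.factorial : ℝ)
  rw [zero_div] at h2
  refine h2.congr' ?_
  filter_upwards [eventually_ge_atTop (0 : ℝ)] with t ht
  simp only [coefA, norm_mul, norm_div, norm_pow, Complex.norm_exp, Complex.norm_real,
    Complex.norm_natCast, Real.norm_eq_abs, abs_of_nonneg ht, Real.rpow_natCast]
  simp
  ring_nf

theorem sol_deriv {E : Type*} [NormedAddCommGroup E] [NormedSpace ℂ E] [NormedSpace ℝ E]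
    [IsScalarTower ℝ ℂ E] (L : Module.End ℂ E) (μ : ℂ) (v : E) (t : ℝ) (k : ℕ) :
    HasDerivAt (fun t => ∑ j ∈ Finset.range (k + 1),
        coefA μ j t • ((L - algebraMap ℂ (Module.End ℂ E) μ) ^ j) v)
      (L (∑ j ∈ Finset.range (k + 1),
        coefA μ j t • ((L - algebraMap ℂ (Module.End ℂ E) μ) ^ j) v)
        - coefA μ k t • ((L - algebraMap ℂ (Module.End ℂ E) μ) ^ (k + 1)) v) t := by
  induction k with
  | zero =>
    have h := (coefA_deriv_zero μ t).smul_const v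
    simp only [zero_add, Finset.sum_range_one, pow_zero, pow_one, Module.End.one_apply]
    refine h.congr_deriv ?_
    simp [Module.algebraMap_end_apply, smul_sub, mul_smul, smul_comm μ]
  | succ k ih =>
    have h := (coefA_deriv_succ μ k t).smul_const
      (((L - algebraMap ℂ (Module.End ℂ E) μ) ^ (k + 1)) v)
    have h2 := ih.add h
    have he : (fun t => ∑ j ∈ Finset.range (k + 1 + 1),
        coefA μ j t • ((L - algebraMap ℂ (Module.End ℂ E) μ) ^ j) v) =
        (fun t => ∑ j ∈ Finset.range (k + 1),
        coefA μ j t • ((L - algebraMap ℂ (Module.End ℂ E) μ) ^ j) v) +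
        (fun t => coefA μ (k + 1) t • ((L - algebraMap ℂ (Module.End ℂ E) μ) ^ (k + 1)) v) := by
      funext s
      rw [Finset.sum_range_succ]; rfl
    rw [he]
    refine h2.congr_deriv ?_
    rw [Finset.sum_range_succ _ (k + 1), map_add, pow_succ' _ (k + 1), Module.End.mul_apply]
    simp only [LinearMap.sub_apply, Module.algebraMap_end_apply, map_smul, smul_sub, mul_smul,
      add_smul, smul_comm μ]
    abel

/-- initial values from which a convergent solution exists -/
def convSub {E : Type*} [NormedAddCommGroup E] [NormedSpace ℂ E] [NormedSpace ℝ E]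
    [IsScalarTower ℝ ℂ E] (L : Module.End ℂ E) : Submodule ℂ E where
  carrier := {v | ∃ y : ℝ → E, y 0 = v ∧ (∀ t, HasDerivAt y (L (y t)) t) ∧
    ∃ l, Tendsto y atTop (nhds l)}
  add_mem' := by
    rintro a b ⟨y, hy0, hy, l, hl⟩ ⟨z, hz0, hz, m, hm⟩
    refine ⟨y + z, by simp [hy0, hz0], fun t => ?_, l + m, hl.add hm⟩
    simpa using (hy t).add (hz t)
  zero_mem' := ⟨fun _ => 0, rfl, fun t => by simpa using hasDerivAt_const t (0 : E), 0,
    tendsto_const_nhds⟩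
  smul_mem' := by
    rintro c a ⟨y, hy0, hy, l, hl⟩
    refine ⟨c • y, by simp [hy0], fun t => ?_, c • l, hl.const_smul c⟩
    simpa using (hy t).const_smul c

theorem convSub_top {E : Type*} [NormedAddCommGroup E] [NormedSpace ℂ E] [NormedSpace ℝ E]
    [IsScalarTower ℝ ℂ E] [FiniteDimensional ℂ E] (L : Module.End ℂ E)
    (h0 : ∀ x, L (L x) = 0 → L x = 0)
    (h1 : ∀ (μ : ℂ) (x : E), x ≠ 0 → L x = μ • x → μ ≠ 0 → μ.re < 0) :
    convSub L = ⊤ := by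
  rw [eq_top_iff, ← Module.End.iSup_maxGenEigenspace_eq_top L]
  refine iSup_le fun μ v hv => ?_
  rw [Module.End.mem_maxGenEigenspace] at hv
  obtain ⟨k, hk⟩ := hv
  by_cases hμ : μ = 0
  · subst hμ
    have hLv : L v = 0 := ker_pow_aux L h0 k v (by simpa using hk)
    exact ⟨fun _ => v, rfl, fun t => by simpa [hLv] using hasDerivAt_const t v, v,
      tendsto_const_nhds⟩
  by_cases hv0 : v = 0
  · rw [hv0]; exact zero_mem _
  have hre : μ.re < 0 := by
    by_contra hre
    have hinj : ∀ x, (L - μ • (1 : Module.End ℂ E)) x = 0 → x = 0 := by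
      intro x hx
      by_contra hx0
      exact hre (h1 μ x hx0 (by simpa [sub_eq_zero] using hx) hμ)
    have : ∀ (k : ℕ) (x : E), ((L - μ • (1 : Module.End ℂ E)) ^ k) x = 0 → x = 0 := by
      intro k
      induction k with
      | zero => intro x hx; simpa using hx
      | succ k ih =>
        intro x hx
        rw [pow_succ, Module.End.mul_apply] at hx
        exact hinj _ (ih _ hx)
    exact hv0 (this k v hk)
  have e1 : L - μ • (1 : Module.End ℂ E) = L - algebraMap ℂ (Module.End ℂ E) μ := by
    rw [Algebra.algebraMap_eq_smul_one]
  rw [e1] at hk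
  refine ⟨_, ?_, fun t => (sol_deriv L μ v t k).congr_deriv ?_, 0, ?_⟩
  · rw [Finset.sum_range_succ', Finset.sum_eq_zero]
    · simp [coefA]
    · intro i _; simp [coefA]
  · rw [pow_succ', Module.End.mul_apply, hk]; simp
  · have := tendsto_finsetSum (Finset.range (k + 1)) (fun j _ =>
      (coefA_tendsto μ hre j).smul_const (((L - algebraMap ℂ (Module.End ℂ E) μ) ^ j) v))
    simpa using this

theorem conv_all {E : Type*} [NormedAddCommGroup E] [NormedSpace ℂ E] [NormedSpace ℝ E]
    [IsScalarTower ℝ ℂ E] [FiniteDimensional ℂ E] (L : Module.End ℂ E)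
    (h0 : ∀ x, L (L x) = 0 → L x = 0)
    (h1 : ∀ (μ : ℂ) (x : E), x ≠ 0 → L x = μ • x → μ ≠ 0 → μ.re < 0)
    (z : ℝ → E) (hz : ∀ t, 0 ≤ t → HasDerivAt z (L (z t)) t) :
    ∃ l, Tendsto z atTop (nhds l) := by
  have hm : z 0 ∈ convSub L := by rw [convSub_top L h0 h1]; trivial
  obtain ⟨y, hy0, hy, l, hl⟩ := hm
  refine ⟨l, hl.congr' ?_⟩
  filter_upwards [eventually_ge_atTop (0 : ℝ)] with b hb
  have hLip : LipschitzWith ‖LinearMap.toContinuousLinearMap L‖₊ (fun x => L x) :=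
    (LinearMap.toContinuousLinearMap L).lipschitz
  have := ODE_solution_unique (v := fun _ x => L x) (fun _ => hLip)
    (f := y) (g := z) (a := 0) (b := b)
    (fun t _ => (hy t).continuousAt.continuousWithinAt) (fun t _ => (hy t).hasDerivWithinAt)
    (fun t ht => (hz t ht.1).continuousAt.continuousWithinAt)
    (fun t ht => (hz t ht.1).hasDerivWithinAt) hy0
  exact this ⟨hb, le_rfl⟩
end
section
open scoped ComplexOrder
variable {n m : ℕ}

theorem trace_nonneg_aux {p q : ℕ} (A : Matrix (Fin p) (Fin q) ℂ) :
    ∃ r : ℝ, 0 ≤ r ∧ trace (Aᴴ * A) = r ∧ (r = 0 → A = 0) := by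
  have h := (Matrix.posSemidef_conjTranspose_mul_self A).trace_nonneg
  rw [Complex.nonneg_iff] at h
  refine ⟨(trace (Aᴴ * A)).re, h.1, ?_, fun h0 => ?_⟩
  · apply Complex.ext <;> simp [← h.2]
  · apply Matrix.trace_conjTranspose_mul_self_eq_zero_iff.1
    apply Complex.ext <;> simp [← h.2, h0]

/-- The Lindblad generator. -/
noncomputable def genL (T : Matrix (Fin n) (Fin n) ℂ) (Θ : Matrix (Fin n) (Fin m) ℂ) :
    Module.End ℂ (Matrix (Fin n) (Fin n) ℂ) where
  toFun M := (-Complex.I) • (T * M - M * T) - (1/2 : ℂ) • (Θ * Θᴴ * M + M * (Θ * Θᴴ))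
  map_add' A B := by simp only [mul_add, add_mul]; module
  map_smul' c A := by
    simp only [mul_smul_comm, smul_mul_assoc, RingHom.id_apply]; module

theorem genL_apply (T : Matrix (Fin n) (Fin n) ℂ) (Θ : Matrix (Fin n) (Fin m) ℂ) (M) :
    genL T Θ M = (-Complex.I) • (T * M - M * T)
      - (1/2 : ℂ) • (Θ * Θᴴ * M + M * (Θ * Θᴴ)) := rfl

theorem trace_herm_real (T : Matrix (Fin n) (Fin n) ℂ) (hT : T.IsHermitian)
    (M : Matrix (Fin n) (Fin n) ℂ) : (trace (Mᴴ * (T * M - M * T))).im = 0 := by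
  rw [← Complex.conj_eq_iff_im]
  change star _ = _
  rw [← trace_conjTranspose]
  simp only [conjTranspose_mul, conjTranspose_sub, conjTranspose_conjTranspose, hT.eq,
    mul_sub, trace_sub]
  rw [Matrix.mul_assoc, Matrix.mul_assoc, trace_mul_comm T (Mᴴ * M), Matrix.mul_assoc]

theorem genL_eig (T : Matrix (Fin n) (Fin n) ℂ) (hT : T.IsHermitian)
    (Θ : Matrix (Fin n) (Fin m) ℂ) (M : Matrix (Fin n) (Fin n) ℂ) (μ : ℂ)
    (h : genL T Θ M = μ • M) (hμ : 0 ≤ μ.re) :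
    Θᴴ * M = 0 ∧ M * Θ = 0 ∧ (-Complex.I) • (T * M - M * T) = μ • M ∧ (M ≠ 0 → μ.re = 0) := by
  obtain ⟨r, hr, hr1, hr2⟩ := trace_nonneg_aux M
  obtain ⟨a, ha, ha1, ha2⟩ := trace_nonneg_aux (Θᴴ * M)
  obtain ⟨b, hb, hb1, hb2⟩ := trace_nonneg_aux ((M * Θ)ᴴ)
  have ht := trace_herm_real T hT M
  have h1 : trace (Mᴴ * genL T Θ M) = μ * r := by
    rw [h, mul_smul_comm, trace_smul, hr1, smul_eq_mul]
  have ea : trace (Mᴴ * (Θ * Θᴴ * M)) = a := by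
    rw [← ha1]; simp [Matrix.mul_assoc]
  have eb : trace (Mᴴ * (M * (Θ * Θᴴ))) = b := by
    rw [← hb1, trace_mul_comm, conjTranspose_conjTranspose, conjTranspose_mul]
    simp only [← Matrix.mul_assoc]
  rw [genL_apply, mul_sub, mul_smul_comm, mul_smul_comm, trace_sub, trace_smul, trace_smul,
    mul_add, trace_add, ea, eb] at h1
  have h2 := congrArg Complex.re h1
  simp [ht] at h2
  have h3 : 0 ≤ μ.re * r := mul_nonneg hμ hr
  have a0 : a = 0 := by nlinarith
  have b0 : b = 0 := by nlinarith
  have hA := ha2 a0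
  have hB : M * Θ = 0 := conjTranspose_eq_zero.1 (hb2 b0)
  refine ⟨hA, hB, ?_, fun hM => ?_⟩
  · rw [← h, genL_apply, Matrix.mul_assoc, hA, ← Matrix.mul_assoc, hB]; simp
  · have : μ.re * r = 0 := by nlinarith
    rcases mul_eq_zero.1 this with h | h
    · exact h
    · exact absurd (hr2 h) hM

theorem genL_orth (T : Matrix (Fin n) (Fin n) ℂ) (hT : T.IsHermitian)
    (Θ : Matrix (Fin n) (Fin m) ℂ) (w x : Matrix (Fin n) (Fin n) ℂ)
    (h : genL T Θ w = 0) : trace (wᴴ * genL T Θ x) = 0 := by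
  obtain ⟨h1, h2, h3, -⟩ := genL_eig T hT Θ w 0 (by simpa using h) (by simp)
  have h4 : T * w = w * T := by
    rw [zero_smul] at h3
    have := (smul_eq_zero.1 h3).resolve_left (by simp)
    exact sub_eq_zero.1 this
  have h5 : wᴴ * T = T * wᴴ := by
    have := congrArg conjTranspose h4
    simpa [hT.eq] using this
  have h6 : wᴴ * Θ = 0 := by simpa using congrArg conjTranspose h1
  have h7 : Θᴴ * wᴴ = 0 := by simpa using congrArg conjTranspose h2
  have e1 : trace (wᴴ * (T * x)) = trace (wᴴ * (x * T)) := by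
    rw [← Matrix.mul_assoc, h5, Matrix.mul_assoc, trace_mul_comm, Matrix.mul_assoc]
  have e2 : wᴴ * (Θ * Θᴴ * x) = 0 := by
    rw [← Matrix.mul_assoc, ← Matrix.mul_assoc, h6]; simp
  have e3 : trace (wᴴ * (x * (Θ * Θᴴ))) = 0 := by
    rw [← Matrix.mul_assoc, trace_mul_comm, Matrix.mul_assoc, ← Matrix.mul_assoc Θᴴ, h7]; simp
  rw [genL_apply, mul_sub, mul_smul_comm, mul_smul_comm, trace_sub, trace_smul, trace_smul,
    mul_add, mul_sub, trace_add, trace_sub, e1, e2, e3]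
  simp

theorem genL_ker (T : Matrix (Fin n) (Fin n) ℂ) (hT : T.IsHermitian)
    (Θ : Matrix (Fin n) (Fin m) ℂ) (x : Matrix (Fin n) (Fin n) ℂ)
    (h : genL T Θ (genL T Θ x) = 0) : genL T Θ x = 0 :=
  Matrix.trace_conjTranspose_mul_self_eq_zero_iff.1 (genL_orth T hT Θ _ x h)

theorem genL_stationary (T : Matrix (Fin n) (Fin n) ℂ) (hT : T.IsHermitian)
    (Θ : Matrix (Fin n) (Fin m) ℂ) (B : Matrix (Fin m) (Fin m) ℂ) :
    ∃ x, genL T Θ x + Θ * B * Θᴴ = 0 := by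
  have hd : Disjoint (LinearMap.ker (genL T Θ)) (LinearMap.range (genL T Θ)) := by
    rw [Submodule.disjoint_def]
    rintro _ h1 ⟨x, rfl⟩
    exact genL_ker T hT Θ x h1
  have hc : IsCompl (LinearMap.ker (genL T Θ)) (LinearMap.range (genL T Θ)) := by
    rw [Submodule.isCompl_iff_disjoint _ _ ?_]
    · exact hd
    · rw [← LinearMap.finrank_range_add_finrank_ker (genL T Θ), add_comm]
  have hm : Θ * B * Θᴴ ∈ LinearMap.ker (genL T Θ) ⊔ LinearMap.range (genL T Θ) := by
    rw [hc.sup_eq_top]; trivial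
  obtain ⟨k, hk, _, ⟨x, rfl⟩, hkx⟩ := Submodule.mem_sup.1 hm
  have hk : genL T Θ k = 0 := hk
  obtain ⟨h1, -, -, -⟩ := genL_eig T hT Θ k 0 (by simpa using hk) (by simp)
  have h6 : kᴴ * Θ = 0 := by simpa using congrArg conjTranspose h1
  have : trace (kᴴ * k) = 0 := by
    have e : k = Θ * B * Θᴴ - genL T Θ x := by rw [← hkx]; simp
    have e' : trace (kᴴ * k) = trace (kᴴ * (Θ * B * Θᴴ - genL T Θ x)) := congrArg _ (congrArg _ e)
    rw [e', mul_sub, trace_sub, genL_orth T hT Θ k x hk, ← Matrix.mul_assoc,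
      ← Matrix.mul_assoc, h6]
    simp
  have hk0 := Matrix.trace_conjTranspose_mul_self_eq_zero_iff.1 this
  refine ⟨-x, ?_⟩
  rw [← hkx, hk0]; simp

theorem mem_W (T : Matrix (Fin n) (Fin n) ℂ) (hT : T.IsHermitian)
    (Θ : Matrix (Fin n) (Fin m) ℂ) (u : Fin n → ℂ) :
    u ∈ orthoComp (kalmanSpace T Θ) ↔ ∀ k : ℕ, Θᴴ *ᵥ (T ^ k *ᵥ u) = 0 := by
  have key : ∀ (k : ℕ) (x : Fin m → ℂ),
      star ((T ^ k * Θ) *ᵥ x) ⬝ᵥ u = star x ⬝ᵥ (Θᴴ *ᵥ (T ^ k *ᵥ u)) := by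
    intro k x
    rw [star_mulVec, ← dotProduct_mulVec, conjTranspose_mul, conjTranspose_pow, hT.eq,
      mulVec_mulVec]
  constructor
  · intro h k
    have := h _ (Submodule.subset_span ⟨k, Θᴴ *ᵥ (T ^ k *ᵥ u), rfl⟩)
    rw [key] at this
    exact dotProduct_star_self_eq_zero.1 this
  · intro h v hv
    induction hv using Submodule.span_induction with
    | mem v hv =>
      obtain ⟨k, x, rfl⟩ := hv
      rw [key, h k]; simp
    | zero => simp
    | add a b _ _ ha hb => simp [add_dotProduct, ha, hb]
    | smul c a _ ha => simp [smul_dotProduct, ha]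

theorem eig_mem_W (T : Matrix (Fin n) (Fin n) ℂ) (hT : T.IsHermitian)
    (Θ : Matrix (Fin n) (Fin m) ℂ) (u : Fin n → ℂ) (lam : ℂ) (h : T *ᵥ u = lam • u)
    (h2 : Θᴴ *ᵥ u = 0) : u ∈ orthoComp (kalmanSpace T Θ) := by
  rw [mem_W T hT]
  have : ∀ k : ℕ, T ^ k *ᵥ u = lam ^ k • u := by
    intro k
    induction k with
    | zero => simp
    | succ k ih => rw [pow_succ, ← mulVec_mulVec, h, mulVec_smul, ih, smul_smul, pow_succ']
  intro k
  rw [this, mulVec_smul, h2, smul_zero]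

theorem herm_eig_real (T : Matrix (Fin n) (Fin n) ℂ) (hT : T.IsHermitian) (y : Fin n → ℂ)
    (μ : ℂ) (hy : y ≠ 0) (h : T *ᵥ y = μ • y) : star μ = μ := by
  have h1 : star y ⬝ᵥ (T *ᵥ y) = μ * (star y ⬝ᵥ y) := by rw [h, dotProduct_smul, smul_eq_mul]
  have h2 : star y ⬝ᵥ (T *ᵥ y) = star μ * (star y ⬝ᵥ y) := by
    rw [dotProduct_mulVec, ← hT.eq, ← star_mulVec, h, star_smul, smul_dotProduct, smul_eq_mul]
  have h3 : star y ⬝ᵥ y ≠ 0 := fun h0 => hy (dotProduct_star_self_eq_zero.1 h0)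
  exact mul_right_cancel₀ h3 (h2.symm.trans h1)

theorem herm_semisimple (T : Matrix (Fin n) (Fin n) ℂ) (hT : T.IsHermitian) (x y : Fin n → ℂ)
    (μ : ℂ) (hy : y = T *ᵥ x - μ • x) (h : T *ᵥ y = μ • y) : y = 0 := by
  by_contra hy0
  have hr := herm_eig_real T hT y μ hy0 h
  have h2 : star y ⬝ᵥ (T *ᵥ x) = star μ * (star y ⬝ᵥ x) := by
    rw [dotProduct_mulVec, ← hT.eq, ← star_mulVec, h, star_smul, smul_dotProduct, smul_eq_mul]
  have h3 : star y ⬝ᵥ y = 0 := by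
    have e' : star y ⬝ᵥ y = star y ⬝ᵥ (T *ᵥ x - μ • x) := congrArg _ hy
    rw [e', dotProduct_sub, h2, dotProduct_smul, hr, smul_eq_mul, sub_self]
  exact hy0 (dotProduct_star_self_eq_zero.1 h3)

theorem two_iff_three (T : Matrix (Fin n) (Fin n) ℂ) (hT : T.IsHermitian)
    (Θ : Matrix (Fin n) (Fin m) ℂ) :
    (∀ (u v : Fin n → ℂ) (lam mu : ℂ), u ≠ 0 → v ≠ 0 →
        T.mulVec u = lam • u → T.mulVec v = mu • v →
        Θᴴ.mulVec u = 0 → Θᴴ.mulVec v = 0 → lam = mu) ↔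
      (∃ lam : ℂ, ∀ u ∈ orthoComp (kalmanSpace T Θ), T.mulVec u = lam • u) := by
  constructor
  · intro h
    have hinv : ∀ u ∈ orthoComp (kalmanSpace T Θ),
        Matrix.toLin' T u ∈ orthoComp (kalmanSpace T Θ) := by
      intro u hu
      rw [mem_W T hT] at hu ⊢
      intro k
      rw [toLin'_apply, mulVec_mulVec _ (T ^ k), ← pow_succ]
      exact hu (k + 1)
    have hker : ∀ u ∈ orthoComp (kalmanSpace T Θ), Θᴴ *ᵥ u = 0 := by
      intro u hu
      simpa using (mem_W T hT Θ u).1 hu 0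
    have hlam : ∃ lam : ℂ, ∀ u ∈ orthoComp (kalmanSpace T Θ), u ≠ 0 →
        ∀ μ : ℂ, T *ᵥ u = μ • u → μ = lam := by
      by_cases hex : ∃ u ∈ orthoComp (kalmanSpace T Θ), u ≠ 0 ∧ ∃ lam : ℂ, T *ᵥ u = lam • u
      · obtain ⟨u, hu, hu0, lam, hl⟩ := hex
        exact ⟨lam, fun v hv hv0 μ hμ => h v u μ lam hv0 hu0 hμ hl (hker v hv) (hker u hu)⟩
      · exact ⟨0, fun u hu hu0 μ hμ => absurd ⟨u, hu, hu0, μ, hμ⟩ hex⟩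
    obtain ⟨lam, hlam⟩ := hlam
    refine ⟨lam, ?_⟩
    set f : Module.End ℂ (orthoComp (kalmanSpace T Θ)) := (Matrix.toLin' T).restrict hinv with hf
    have hfa : ∀ w, ((f w : orthoComp (kalmanSpace T Θ)) : Fin n → ℂ) = T *ᵥ (w : Fin n → ℂ) := by
      intro w; rfl
    have htop : (⊤ : Submodule ℂ (orthoComp (kalmanSpace T Θ))) ≤
        LinearMap.ker (f - lam • (1 : Module.End ℂ _)) := by
      rw [← Module.End.iSup_maxGenEigenspace_eq_top f]
      refine iSup_le fun μ w hw => ?_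
      rw [Module.End.mem_maxGenEigenspace] at hw
      obtain ⟨k, hk⟩ := hw
      have hw1 : (f - μ • (1 : Module.End ℂ (orthoComp (kalmanSpace T Θ)))) w = 0 := by
        refine ker_pow_aux _ (fun x hx => ?_) k w hk
        have hx' := congrArg Subtype.val hx
        apply Subtype.ext
        refine herm_semisimple T hT x _ μ ?_ ?_
        · simp [hfa]
        · rw [LinearMap.sub_apply] at hx'
          simp only [Submodule.coe_sub, hfa] at hx'
          exact sub_eq_zero.1 hx'
      have hw2 : T *ᵥ (w : Fin n → ℂ) = μ • (w : Fin n → ℂ) := by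
        have := congrArg Subtype.val hw1
        simp only [LinearMap.sub_apply, Submodule.coe_sub, hfa] at this
        exact sub_eq_zero.1 this
      by_cases hw0 : (w : Fin n → ℂ) = 0
      · have : w = 0 := Subtype.ext hw0
        rw [this]; exact zero_mem _
      · rw [LinearMap.mem_ker, ← hlam w w.2 hw0 μ hw2]; exact hw1
    intro u hu
    have := htop (show (⟨u, hu⟩ : orthoComp (kalmanSpace T Θ)) ∈ ⊤ from trivial)
    have := congrArg Subtype.val (LinearMap.mem_ker.1 this)
    simp only [LinearMap.sub_apply, Submodule.coe_sub, hfa] at this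
    exact sub_eq_zero.1 this
  · rintro ⟨l, hl⟩ u v lam mu hu hv h1 h2 h3 h4
    have a := hl u (eig_mem_W T hT Θ u lam h1 h3)
    have b := hl v (eig_mem_W T hT Θ v mu h2 h4)
    rw [h1] at a
    rw [h2] at b
    rw [smul_left_injective ℂ hu a, smul_left_injective ℂ hv b]

theorem W_cols (T : Matrix (Fin n) (Fin n) ℂ) (hT : T.IsHermitian)
    (Θ : Matrix (Fin n) (Fin m) ℂ) (lam : ℂ)
    (h3 : ∀ u ∈ orthoComp (kalmanSpace T Θ), T.mulVec u = lam • u)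
    (M : Matrix (Fin n) (Fin n) ℂ) (S : Matrix (Fin n) (Fin n) ℂ) (h1 : Θᴴ * M = 0)
    (h2 : T * M = M * S) : T * M = lam • M := by
  have hp : ∀ k : ℕ, T ^ k * M = M * S ^ k := by
    intro k
    induction k with
    | zero => simp
    | succ k ih => rw [pow_succ, Matrix.mul_assoc, h2, ← Matrix.mul_assoc, ih, Matrix.mul_assoc,
        ← pow_succ]
  have : ∀ x, (T * M) *ᵥ x = (lam • M) *ᵥ x := by
    intro x
    rw [← mulVec_mulVec, smul_mulVec]
    apply h3
    rw [mem_W T hT]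
    intro k
    rw [mulVec_mulVec, mulVec_mulVec, Matrix.mul_assoc, hp, ← Matrix.mul_assoc, h1]
    simp
  exact Matrix.ext_of_mulVec_single fun i => this _

theorem genL_spec (T : Matrix (Fin n) (Fin n) ℂ) (hT : T.IsHermitian)
    (Θ : Matrix (Fin n) (Fin m) ℂ) (lam : ℂ)
    (h3 : ∀ u ∈ orthoComp (kalmanSpace T Θ), T.mulVec u = lam • u)
    (μ : ℂ) (M : Matrix (Fin n) (Fin n) ℂ) (hM : M ≠ 0) (h : genL T Θ M = μ • M)
    (hμ : μ ≠ 0) : μ.re < 0 := by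
  by_contra hre
  push Not at hre
  obtain ⟨a, b, c, d⟩ := genL_eig T hT Θ M μ h hre
  have hre0 := d hM
  have hmu : star μ = -μ := by
    apply Complex.ext <;> simp [hre0]
  have c1 : T * M - M * T = (Complex.I * μ) • M := by
    rw [mul_smul, ← c, smul_smul]; simp
  have e1 : T * M = M * (T + (Complex.I * μ) • 1) := by
    rw [mul_add, mul_smul_comm, mul_one, ← c1]; simp
  have e2 : T * Mᴴ = Mᴴ * (T - (Complex.I * μ) • 1) := by
    have := congrArg conjTranspose c1
    simp only [conjTranspose_sub, conjTranspose_mul, hT.eq, conjTranspose_smul, star_mul', hmu] at this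
    rw [mul_sub, mul_smul_comm, mul_one]
    have e : star Complex.I * -μ = Complex.I * μ := by simp
    rw [e] at this
    rw [← this]
    abel
  have f1 := W_cols T hT Θ lam h3 M _ a e1
  have f2 := W_cols T hT Θ lam h3 Mᴴ _ (by simpa using congrArg conjTranspose b) e2
  have f3 : M * T = star lam • M := by
    have := congrArg conjTranspose f2
    simpa [hT.eq] using this
  have hl : star lam = lam := by
    have : ∃ x, M *ᵥ x ≠ 0 := by
      by_contra hx
      push Not at hx
      exact hM (Matrix.ext_of_mulVec_single fun i => by rw [hx, zero_mulVec])
    obtain ⟨x, hx⟩ := this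
    refine herm_eig_real T hT _ lam hx ?_
    rw [mulVec_mulVec, f1, smul_mulVec]
  rw [f1, f3, hl, sub_self] at c1
  rcases smul_eq_zero.1 c1.symm with h | h
  · simp [hμ] at h
  · exact hM h
end
section
theorem exp_not_conv (ω : ℝ) (hω : ω ≠ 0) (l : ℂ)
    (h : Tendsto (fun t : ℝ => Complex.exp (t * (ω * Complex.I))) atTop (nhds l)) : False := by
  have h1 : ‖l‖ = 1 := by
    refine tendsto_nhds_unique h.norm ?_
    refine tendsto_const_nhds.congr fun t => ?_
    rw [← mul_assoc, ← Complex.ofReal_mul, Complex.norm_exp_ofReal_mul_I]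
  have h2 := h.comp (tendsto_atTop_add_const_right atTop (Real.pi / ω) tendsto_id)
  have h3 : Tendsto (fun t : ℝ => Complex.exp (t * (ω * Complex.I))) atTop (nhds (-l)) := by
    refine h2.neg.congr fun t => ?_
    have hω' : (ω : ℂ) ≠ 0 := by exact_mod_cast hω
    have e : ((t + Real.pi / ω : ℝ) : ℂ) * (ω * Complex.I)
        = t * (ω * Complex.I) + Real.pi * Complex.I := by
      push_cast; field_simp
    simp only [Function.comp, id]
    rw [e, Complex.exp_add, Complex.exp_pi_mul_I]
    ring
  have h4 : l = -l := tendsto_nhds_unique h h3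
  have h5 : l = 0 := self_eq_neg.1 h4
  simp [h5] at h1

theorem one_imp_two {n m : ℕ}
    (T : Matrix (Fin n) (Fin n) ℂ) (hT : T.IsHermitian)
    (Θ : Matrix (Fin n) (Fin m) ℂ) (M_B : Matrix (Fin m) (Fin m) ℂ)
    (H : ∀ M : ℝ → Matrix (Fin n) (Fin n) ℂ, Differentiable ℝ M →
        (∀ t : ℝ, 0 ≤ t → deriv M t = genL T Θ (M t) + Θ * M_B * Θᴴ) →
        ∃ Minf : Matrix (Fin n) (Fin n) ℂ, Tendsto M atTop (nhds Minf))
    (u v : Fin n → ℂ) (lam mu : ℂ) (hu : u ≠ 0) (hv : v ≠ 0)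
    (h1 : T.mulVec u = lam • u) (h2 : T.mulVec v = mu • v)
    (h3 : Θᴴ.mulVec u = 0) (h4 : Θᴴ.mulVec v = 0) : lam = mu := by
  by_contra hne
  obtain ⟨X, hX⟩ := genL_stationary T hT Θ M_B
  have hl := herm_eig_real T hT u lam hu h1
  have hm := herm_eig_real T hT v mu hv h2
  set ω : ℝ := (mu - lam).re with hω
  have him : ((ω : ℝ) : ℂ) = mu - lam := by
    have a := Complex.conj_eq_iff_im.1 hl
    have b := Complex.conj_eq_iff_im.1 hm
    apply Complex.ext <;> simp [hω, a, b]
  have hω0 : ω ≠ 0 := by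
    intro h0
    rw [h0, Complex.ofReal_zero] at him
    exact hne (sub_eq_zero.1 him.symm).symm
  set P : Matrix (Fin n) (Fin n) ℂ := vecMulVec u (star v) with hP
  have e1 : T * P = lam • P := by rw [hP, mul_vecMulVec, h1, smul_vecMulVec]
  have e2 : P * T = mu • P := by
    have : star v ᵥ* T = mu • star v := by
      rw [← hT.eq, ← star_mulVec, h2, star_smul, hm]
    rw [hP, vecMulVec_mul, this, vecMulVec_smul]
  have e3 : Θᴴ * P = 0 := by rw [hP, mul_vecMulVec, h3, zero_vecMulVec]
  have e4 : P * Θ = 0 := by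
    have : star v ᵥ* Θ = 0 := by
      have := star_mulVec Θᴴ v
      rw [conjTranspose_conjTranspose, h4] at this
      rw [← this]; simp
    rw [hP, vecMulVec_mul, this]
    ext i j
    simp [vecMulVec_apply]
  have hLP : genL T Θ P = (ω * Complex.I) • P := by
    rw [genL_apply, e1, e2, Matrix.mul_assoc, e3, ← Matrix.mul_assoc, e4, him, Matrix.mul_zero,
      Matrix.zero_mul, add_zero, smul_zero, sub_zero]
    module
  have hd : ∀ t : ℝ, HasDerivAt (fun t : ℝ => X + Complex.exp (t * (ω * Complex.I)) • P)
      (genL T Θ (X + Complex.exp (t * (ω * Complex.I)) • P) + Θ * M_B * Θᴴ) t := by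
    intro t
    have h0 : HasDerivAt (fun t : ℝ => (t : ℂ)) 1 t := Complex.ofRealCLM.hasDerivAt (x := t)
    have h := (((h0.mul_const (ω * Complex.I)).cexp).smul_const P).const_add X
    refine h.congr_deriv ?_
    rw [map_add, add_right_comm, hX, zero_add, map_smul, hLP, one_mul, smul_smul]
  obtain ⟨l, hl⟩ := H _ (fun t => (hd t).differentiableAt) (fun t _ => (hd t).deriv)
  obtain ⟨i, hi⟩ := Function.ne_iff.1 hu
  obtain ⟨j, hj⟩ := Function.ne_iff.1 hv
  have hPij : P i j ≠ 0 := by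
    simp only [hP, vecMulVec_apply]
    exact mul_ne_zero hi (by simpa using hj)
  have hlij : Tendsto (fun t : ℝ => (X + Complex.exp (t * (ω * Complex.I)) • P) i j) atTop
      (nhds (l i j)) := (tendsto_pi_nhds.1 ((tendsto_pi_nhds.1 hl) i)) j
  refine exp_not_conv ω hω0 ((l i j - X i j) / P i j) ?_
  refine ((hlij.sub_const (X i j)).div_const (P i j)).congr fun t => ?_
  simp [hPij]

theorem three_imp_one {n m : ℕ}
    (T : Matrix (Fin n) (Fin n) ℂ) (hT : T.IsHermitian)
    (Θ : Matrix (Fin n) (Fin m) ℂ) (M_B : Matrix (Fin m) (Fin m) ℂ)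
    (h3 : ∃ lam : ℂ, ∀ u ∈ orthoComp (kalmanSpace T Θ), T.mulVec u = lam • u)
    (M : ℝ → Matrix (Fin n) (Fin n) ℂ) (hM : Differentiable ℝ M)
    (h : ∀ t : ℝ, 0 ≤ t → deriv M t = genL T Θ (M t) + Θ * M_B * Θᴴ) :
    ∃ Minf : Matrix (Fin n) (Fin n) ℂ, Tendsto M atTop (nhds Minf) := by
  obtain ⟨lam, h3⟩ := h3
  obtain ⟨X, hX⟩ := genL_stationary T hT Θ M_B
  obtain ⟨l, hl⟩ := conv_all (genL T Θ) (genL_ker T hT Θ)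
    (fun μ x hx h hμ => genL_spec T hT Θ lam h3 μ x hx h hμ) (fun t => M t - X) (fun t ht => by
      have := (hM t).hasDerivAt.sub_const X
      refine this.congr_deriv ?_
      refine (h t ht).trans ?_
      rw [map_sub, ← neg_eq_of_add_eq_zero_right hX]
      abel)
  refine ⟨l + X, ?_⟩
  have := hl.add_const X
  exact this.congr fun t => sub_add_cancel (M t) X
end

/-- Equivalence between: (1) convergence of every solution of the covariance master
equation (the limit may depend on the initial condition); (2) any two eigenvectors of `T`
lying in `ker Θᴴ` share the same eigenvalue; (3) the orthogonal complement of the Kalman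
space is contained in a single eigenspace of `T`. -/
theorem covariance_convergence_iff {n m : ℕ}
    (T : Matrix (Fin n) (Fin n) ℂ) (hT : T.IsHermitian)
    (Θ : Matrix (Fin n) (Fin m) ℂ) (M_B : Matrix (Fin m) (Fin m) ℂ) :
    ((∀ M : ℝ → Matrix (Fin n) (Fin n) ℂ, Differentiable ℝ M →
        (∀ t : ℝ, 0 ≤ t → deriv M t =
          (-Complex.I) • (T * M t - M t * T)
            - (1/2 : ℂ) • (Θ * Θᴴ * M t + M t * (Θ * Θᴴ)) + Θ * M_B * Θᴴ) →
        ∃ Minf : Matrix (Fin n) (Fin n) ℂ, Tendsto M atTop (nhds Minf)) ↔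
      (∀ (u v : Fin n → ℂ) (lam mu : ℂ), u ≠ 0 → v ≠ 0 →
        T.mulVec u = lam • u → T.mulVec v = mu • v →
        Θᴴ.mulVec u = 0 → Θᴴ.mulVec v = 0 → lam = mu)) ∧
    ((∀ (u v : Fin n → ℂ) (lam mu : ℂ), u ≠ 0 → v ≠ 0 →
        T.mulVec u = lam • u → T.mulVec v = mu • v →
        Θᴴ.mulVec u = 0 → Θᴴ.mulVec v = 0 → lam = mu) ↔
      (∃ lam : ℂ, ∀ u ∈ orthoComp (kalmanSpace T Θ), T.mulVec u = lam • u)) := by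
  exact ⟨⟨fun H => one_imp_two T hT Θ M_B H,
    fun h M hM hd => three_imp_one T hT Θ M_B ((two_iff_three T hT Θ).1 h) M hM hd⟩,
    two_iff_three T hT Θ⟩
end

section
/- Let T be a Hermitian n×n complex matrix, Θ an n×m complex matrix, and M_B an m×m complex matrix. If ker Θᴴ contains no eigenvector of T, then there exists exactly one n×n complex matrix M satisfying -i•(T*M - M*T) - (1/2)•(Θ*Θᴴ*M + M*Θ*Θᴴ) + Θ*M_B*Θᴴ = 0; moreover, if M_B is Hermitian then this unique stationary matrix M is Hermitian. -/
open Matrix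

open scoped ComplexOrder in
lemma kernel_trivial_aux {n m : ℕ}
    (T : Matrix (Fin n) (Fin n) ℂ) (hT : T.IsHermitian)
    (Θ : Matrix (Fin n) (Fin m) ℂ)
    (h : ¬ ∃ (u : Fin n → ℂ) (μ : ℂ), u ≠ 0 ∧ T.mulVec u = μ • u ∧ Θᴴ.mulVec u = 0)
    (M : Matrix (Fin n) (Fin n) ℂ)
    (hM : (-Complex.I) • (T * M - M * T)
        - (1/2 : ℂ) • (Θ * Θᴴ * M + M * (Θ * Θᴴ)) = 0) : M = 0 := by
  have hT' : Tᴴ = T := hT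
  have e1 : (-Complex.I) * trace (Mᴴ * (T * M - M * T))
      = (1/2 : ℂ) * (trace ((Θᴴ * M)ᴴ * (Θᴴ * M)) + trace ((M * Θ)ᴴ * (M * Θ))) := by
    have h0 := congrArg (fun N => trace (Mᴴ * N)) (sub_eq_zero.mp hM)
    simp only [Matrix.mul_smul, trace_smul, smul_eq_mul] at h0
    rw [h0, Matrix.mul_add, trace_add]
    congr 2
    · simp [Matrix.mul_assoc]
    · rw [conjTranspose_mul, Matrix.mul_assoc Θᴴ, Matrix.trace_mul_comm Θᴴ]
      simp [Matrix.mul_assoc]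
  have e2 : star (trace (Mᴴ * (T * M - M * T))) = trace (Mᴴ * (T * M - M * T)) := by
    rw [← trace_conjTranspose, Matrix.mul_sub, conjTranspose_sub, trace_sub, trace_sub]
    congr 1
    · simp [hT', Matrix.mul_assoc]
    · rw [← Matrix.mul_assoc, conjTranspose_mul, Matrix.trace_mul_comm]
      simp [hT']
  have p1 : 0 ≤ trace ((Θᴴ * M)ᴴ * (Θᴴ * M)) :=
    (posSemidef_conjTranspose_mul_self _).trace_nonneg
  have p2 : 0 ≤ trace ((M * Θ)ᴴ * (M * Θ)) :=
    (posSemidef_conjTranspose_mul_self _).trace_nonneg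
  have e3 : (trace (Mᴴ * (T * M - M * T))).im = 0 := Complex.conj_eq_iff_im.mp e2
  have z1 : trace ((Θᴴ * M)ᴴ * (Θᴴ * M)) = 0 := by
    have := congrArg Complex.re e1
    rw [Complex.le_def] at p1 p2
    simp [e3] at this p1 p2
    apply Complex.ext
    · simp; linarith [p1.1, p2.1]
    · simp [← p1.2]
  have z2 : trace ((M * Θ)ᴴ * (M * Θ)) = 0 := by
    have := congrArg Complex.re e1
    rw [Complex.le_def] at p1 p2
    simp [e3] at this p1 p2
    apply Complex.ext
    · simp; linarith [p1.1, p2.1]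
    · simp [← p2.2]
  rw [trace_conjTranspose_mul_self_eq_zero_iff] at z1 z2
  have hc : T * M = M * T := by
    rw [Matrix.mul_assoc, z1, ← Matrix.mul_assoc, z2] at hM
    simpa [sub_eq_zero] using hM
  by_contra hne
  let V := LinearMap.range (toLin' M)
  have hV : ∀ x ∈ V, toLin' T x ∈ V := by
    rintro x ⟨y, rfl⟩
    refine ⟨T *ᵥ y, ?_⟩
    simp [hc]
  have hnt : Nontrivial V := by
    rw [Submodule.nontrivial_iff_ne_bot]
    intro hb
    apply hne
    have := LinearMap.range_eq_bot.mp hb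
    simpa using this
  obtain ⟨μ, hμ⟩ := Module.End.exists_eigenvalue ((toLin' T).restrict hV)
  obtain ⟨v, hv⟩ := hμ.exists_hasEigenvector
  refine h ⟨v, μ, ?_, ?_, ?_⟩
  · simpa using hv.2
  · have := congrArg Subtype.val hv.apply_eq_smul
    simpa using this
  · obtain ⟨y, hy⟩ := v.2
    rw [← hy, toLin'_apply, mulVec_mulVec, z1, zero_mulVec]

/-- If `ker Θᴴ` contains no eigenvector of the Hermitian matrix `T`, then the stationarity
condition of the covariance master equation has a unique solution `M`; moreover if `M_B`
is Hermitian then this unique stationary matrix is Hermitian. -/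
theorem stationary_covariance_unique {n m : ℕ}
    (T : Matrix (Fin n) (Fin n) ℂ) (hT : T.IsHermitian)
    (Θ : Matrix (Fin n) (Fin m) ℂ) (M_B : Matrix (Fin m) (Fin m) ℂ)
    (h : ¬ ∃ (u : Fin n → ℂ) (μ : ℂ), u ≠ 0 ∧ T.mulVec u = μ • u ∧ Θᴴ.mulVec u = 0) :
    (∃! M : Matrix (Fin n) (Fin n) ℂ,
      (-Complex.I) • (T * M - M * T)
        - (1/2 : ℂ) • (Θ * Θᴴ * M + M * (Θ * Θᴴ)) + Θ * M_B * Θᴴ = 0) ∧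
    (M_B.IsHermitian →
      ∀ M : Matrix (Fin n) (Fin n) ℂ,
        (-Complex.I) • (T * M - M * T)
          - (1/2 : ℂ) • (Θ * Θᴴ * M + M * (Θ * Θᴴ)) + Θ * M_B * Θᴴ = 0 →
        M.IsHermitian) := by
  let L : Matrix (Fin n) (Fin n) ℂ →ₗ[ℂ] Matrix (Fin n) (Fin n) ℂ :=
    { toFun := fun M => (-Complex.I) • (T * M - M * T)
        - (1/2 : ℂ) • (Θ * Θᴴ * M + M * (Θ * Θᴴ))
      map_add' := by
        intro A B
        simp only [Matrix.mul_add, Matrix.add_mul]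
        module
      map_smul' := by
        intro c A
        simp only [Matrix.mul_smul, Matrix.smul_mul, RingHom.id_apply]
        module }
  have hL : ∀ M, L M = (-Complex.I) • (T * M - M * T)
        - (1/2 : ℂ) • (Θ * Θᴴ * M + M * (Θ * Θᴴ)) := fun _ => rfl
  have hinj : Function.Injective L := by
    rw [← LinearMap.ker_eq_bot, LinearMap.ker_eq_bot']
    intro M hM
    exact kernel_trivial_aux T hT Θ h M hM
  have hsurj : Function.Surjective L := LinearMap.injective_iff_surjective.mp hinj
  simp only [← hL]
  refine ⟨?_, ?_⟩
  · obtain ⟨M, hM⟩ := hsurj (-(Θ * M_B * Θᴴ))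
    refine ⟨M, by simp [hM], ?_⟩
    intro N hN
    apply hinj
    rw [hM]
    exact eq_neg_of_add_eq_zero_left hN
  · intro hB M hM
    have hT' : Tᴴ = T := hT
    have hB' : M_Bᴴ = M_B := hB
    apply hinj
    have h1 := eq_neg_of_add_eq_zero_left hM
    have h2 : L Mᴴ = (L M)ᴴ := by
      simp only [hL, conjTranspose_sub, conjTranspose_add, conjTranspose_smul,
        conjTranspose_mul, conjTranspose_conjTranspose, hT']
      simp
      module
    rw [h2, h1]
    simp [hB', Matrix.mul_assoc]
end

section
/- Let G be an n×n real matrix, λ ∈ ℝ, and u : Fin n → ℂ a vector such that (the complexification of) G satisfies G.mulVec u = (i·λ) • u. Let a, b : Fin n → ℝ be the entrywise real and imaginary parts of u, and set R = vecMulVec a b - vecMulVec b a (i.e., R j k = a j * b k - b j * a k). Then R is real antisymmetric (Rᵀ = -R) and satisfies G*R + R*Gᵀ = 0. -/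
open Matrix

/-- From a purely imaginary eigenvalue `i·λ` of (the complexification of) a real matrix
`G`, with eigenvector `u = a + i·b`, the real matrix `R = a bᵀ - b aᵀ` is antisymmetric
and is a stationary point of the Lyapunov map `R ↦ G*R + R*Gᵀ`. -/
theorem lyapunov_stationary_of_imaginary_eigenvalue {n : ℕ}
    (G : Matrix (Fin n) (Fin n) ℝ) (lam : ℝ) (u : Fin n → ℂ)
    (hu : (G.map (fun x : ℝ => (x : ℂ))).mulVec u = (Complex.I * lam) • u)
    (a b : Fin n → ℝ) (ha : a = fun j => (u j).re) (hb : b = fun j => (u j).im)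
    (R : Matrix (Fin n) (Fin n) ℝ)
    (hR : R = vecMulVec a b - vecMulVec b a) :
    Rᵀ = -R ∧ G * R + R * Gᵀ = 0 := by
  have hGa : G *ᵥ a = -lam • b := by
    funext j
    have h := congrArg Complex.re (congrFun hu j)
    simp [Matrix.mulVec, dotProduct] at h
    simp [Matrix.mulVec, dotProduct, ha, hb, h]
  have hGb : G *ᵥ b = lam • a := by
    funext j
    have h := congrArg Complex.im (congrFun hu j)
    simp [Matrix.mulVec, dotProduct] at h
    simp [Matrix.mulVec, dotProduct, ha, hb, h]
  subst hR
  constructor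
  · ext j k
    simp [vecMulVec_apply]
    ring
  · rw [Matrix.mul_sub, Matrix.sub_mul, mul_vecMulVec, mul_vecMulVec, vecMulVec_mul,
      vecMulVec_mul, vecMul_transpose, vecMul_transpose, hGa, hGb]
    ext j k
    simp [vecMulVec_apply]
    ring
end

section
/- Let T₀ be an L×L complex matrix and Θ₀ an L×K complex matrix. Form the block matrices T = fromBlocks ((1/2)•T₀) 0 0 (-(1/2)•(entrywise conjugate of T₀)) of size 2L×2L and Θ = fromBlocks Θ₀ 0 0 (-(entrywise conjugate of Θ₀)) of size 2L×2K. Then the Kalman space V(T,Θ) equals ℂ^{2L} if and only if the Kalman space V(T₀,Θ₀) equals ℂ^L. -/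
open Matrix

theorem kalmanSpace_eq_top_iff {n m : Type*} [Fintype n] [Fintype m] [DecidableEq n]
    (T : Matrix n n ℂ) (Θ : Matrix n m ℂ) :
    kalmanSpace T Θ = ⊤ ↔ ∀ w : n → ℂ, (∀ k : ℕ, w ᵥ* (T ^ k * Θ) = 0) → w = 0 := by
  classical
  constructor
  · intro h w hw
    have hle : kalmanSpace T Θ ≤ LinearMap.ker (dotProductBilin ℂ ℂ w) := by
      refine Submodule.span_le.2 ?_
      rintro v ⟨k, x, rfl⟩
      simp [dotProductBilin, dotProduct_mulVec, hw k]
    rw [h] at hle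
    apply dotProduct_eq_zero w
    intro v
    have := hle (Submodule.mem_top (x := v))
    simpa [dotProductBilin] using this
  · intro h
    by_contra hne
    obtain ⟨f, hf, hfk⟩ := Submodule.exists_le_ker_of_lt_top _ (lt_top_iff_ne_top.2 hne)
    apply hf
    have hfw : ∀ v, f v = (fun i => f (Pi.single i 1)) ⬝ᵥ v := by
      intro v
      conv_lhs => rw [pi_eq_sum_univ' v]
      simp [dotProduct, mul_comm, Pi.single, Function.update_apply]
    have hw := h (fun i => f (Pi.single i 1)) (by
      intro k
      apply dotProduct_eq_zero
      intro x
      rw [← dotProduct_mulVec, ← hfw]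
      exact hfk (Submodule.subset_span ⟨k, x, rfl⟩))
    refine LinearMap.ext fun v => ?_
    rw [hfw v, hw, zero_dotProduct, LinearMap.zero_apply]

theorem fromBlocks_diag_pow {l : Type*} [Fintype l] [DecidableEq l]
    (A D : Matrix l l ℂ) (k : ℕ) :
    (fromBlocks A 0 0 D) ^ k = fromBlocks (A ^ k) 0 0 (D ^ k) := by
  induction k with
  | zero => simp [fromBlocks_one]
  | succ k ih => simp [pow_succ, ih, fromBlocks_multiply]

theorem conj_block {L K : ℕ}
    (T₀ : Matrix (Fin L) (Fin L) ℂ) (Θ₀ : Matrix (Fin L) (Fin K) ℂ) (v : Fin L → ℂ) (k : ℕ) :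
    v ᵥ* ((-((1/2 : ℂ) • T₀.map (starRingEnd ℂ))) ^ k * (-(Θ₀.map (starRingEnd ℂ)))) = 0 ↔
      (star v) ᵥ* (T₀ ^ k * Θ₀) = 0 := by
  have h1 : (-((1/2 : ℂ) • T₀.map (starRingEnd ℂ))) ^ k * (-(Θ₀.map (starRingEnd ℂ)))
      = (-(-(1/2 : ℂ)) ^ k) • (T₀ ^ k * Θ₀).map (starRingEnd ℂ) := by
    rw [← neg_smul, smul_pow, Matrix.map_mul, Matrix.map_pow]
    simp
  have h2 : v ᵥ* (T₀ ^ k * Θ₀).map (starRingEnd ℂ) = star ((star v) ᵥ* (T₀ ^ k * Θ₀)) := by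
    ext j
    simp [vecMul, dotProduct]
  rw [h1, vecMul_smul, smul_eq_zero, h2, star_eq_zero]
  simp

theorem half_block {L K : ℕ}
    (T₀ : Matrix (Fin L) (Fin L) ℂ) (Θ₀ : Matrix (Fin L) (Fin K) ℂ) (v : Fin L → ℂ) (k : ℕ) :
    v ᵥ* (((1/2 : ℂ) • T₀) ^ k * Θ₀) = 0 ↔ v ᵥ* (T₀ ^ k * Θ₀) = 0 := by
  rw [smul_pow, smul_mul, vecMul_smul, smul_eq_zero]
  simp

/-- Gauge-invariant decomposition: Kalman's criterion for the doubled block matrices holds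
iff it holds for the one-particle matrices `T₀`, `Θ₀`. -/
theorem kalman_fromBlocks_iff {L K : ℕ}
    (T₀ : Matrix (Fin L) (Fin L) ℂ) (Θ₀ : Matrix (Fin L) (Fin K) ℂ) :
    kalmanSpace
        (fromBlocks ((1/2 : ℂ) • T₀) 0 0 (-((1/2 : ℂ) • T₀.map (starRingEnd ℂ))))
        (fromBlocks Θ₀ 0 0 (-(Θ₀.map (starRingEnd ℂ)))) = ⊤ ↔
      kalmanSpace T₀ Θ₀ = ⊤ := by
  rw [kalmanSpace_eq_top_iff, kalmanSpace_eq_top_iff]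
  have key : ∀ (w : Fin L ⊕ Fin L → ℂ) (k : ℕ),
      w ᵥ* ((fromBlocks ((1/2 : ℂ) • T₀) 0 0 (-((1/2 : ℂ) • T₀.map (starRingEnd ℂ)))) ^ k *
        (fromBlocks Θ₀ 0 0 (-(Θ₀.map (starRingEnd ℂ))))) = 0 ↔
      (w ∘ Sum.inl) ᵥ* (T₀ ^ k * Θ₀) = 0 ∧ (star (w ∘ Sum.inr)) ᵥ* (T₀ ^ k * Θ₀) = 0 := by
    intro w k
    rw [fromBlocks_diag_pow, fromBlocks_multiply, vecMul_fromBlocks, ← conj_block,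
      ← half_block]
    simp only [Matrix.mul_zero, Matrix.zero_mul, add_zero, zero_add, vecMul_zero]
    constructor
    · intro h
      exact ⟨funext fun j => congrFun h (Sum.inl j), funext fun j => congrFun h (Sum.inr j)⟩
    · rintro ⟨h, h'⟩
      rw [h, h']
      ext (j | j) <;> rfl
  constructor
  · intro h w hw
    have := h (Sum.elim w 0) (fun k => (key _ k).2 (by simp [hw k]))
    ext j
    exact congrFun this (Sum.inl j)
  · intro h w hw
    have h1 := h (w ∘ Sum.inl) (fun k => ((key w k).1 (hw k)).1)
    have h2 := h (star (w ∘ Sum.inr)) (fun k => ((key w k).1 (hw k)).2)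
    rw [star_eq_zero] at h2
    ext (j | j)
    · exact congrFun h1 j
    · exact congrFun h2 j
end

section
/- Let T₀ be an L×L complex matrix and Θ₀ an L×K complex matrix, and form T = fromBlocks ((1/2)•T₀) 0 0 (-(1/2)•(entrywise conjugate of T₀)) and Θ = fromBlocks Θ₀ 0 0 (-(entrywise conjugate of Θ₀)). Then ker Θᴴ contains no eigenvector of T if and only if ker Θ₀ᴴ contains no eigenvector of T₀. -/
open Matrix

/-- Gauge-invariant form of the spectral criterion: for the doubled block matrices
`T = fromBlocks ((1/2)•T₀) 0 0 (-(1/2)•conj T₀)` and `Θ = fromBlocks Θ₀ 0 0 (-(conj Θ₀))`,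
`ker Θᴴ` contains no eigenvector of `T` iff `ker Θ₀ᴴ` contains no eigenvector of `T₀`. -/
theorem kernel_no_eigenvector_fromBlocks_iff {L K : ℕ}
    (T₀ : Matrix (Fin L) (Fin L) ℂ) (Θ₀ : Matrix (Fin L) (Fin K) ℂ)
    (T : Matrix (Fin L ⊕ Fin L) (Fin L ⊕ Fin L) ℂ)
    (hT : T = fromBlocks ((1/2 : ℂ) • T₀) 0 0 (-((1/2 : ℂ) • T₀.map (starRingEnd ℂ))))
    (Θ : Matrix (Fin L ⊕ Fin L) (Fin K ⊕ Fin K) ℂ)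
    (hΘ : Θ = fromBlocks Θ₀ 0 0 (-(Θ₀.map (starRingEnd ℂ)))) :
    (¬ ∃ (u : Fin L ⊕ Fin L → ℂ) (μ : ℂ), u ≠ 0 ∧ T.mulVec u = μ • u ∧ Θᴴ.mulVec u = 0) ↔
      (¬ ∃ (u : Fin L → ℂ) (μ : ℂ), u ≠ 0 ∧ T₀.mulVec u = μ • u ∧ Θ₀ᴴ.mulVec u = 0) := by
  subst hT hΘ
  refine not_congr ⟨?_, ?_⟩
  · rintro ⟨u, μ, hu, h1, h2⟩
    have e1 : ∀ i, ∑ j, (1/2 : ℂ) * T₀ i j * u (Sum.inl j) = μ * u (Sum.inl i) := by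
      intro i
      simpa [mulVec, dotProduct] using congrFun h1 (Sum.inl i)
    have e2 : ∀ i, -∑ j, (1/2 : ℂ) * (starRingEnd ℂ) (T₀ i j) * u (Sum.inr j)
        = μ * u (Sum.inr i) := by
      intro i
      simpa [mulVec, dotProduct] using congrFun h1 (Sum.inr i)
    have k1 : ∀ i, ∑ j, (starRingEnd ℂ) (Θ₀ j i) * u (Sum.inl j) = 0 := by
      intro i
      simpa [mulVec, dotProduct, conjTranspose_apply] using congrFun h2 (Sum.inl i)
    have k2 : ∀ i, ∑ j, Θ₀ j i * u (Sum.inr j) = 0 := by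
      intro i
      simpa [mulVec, dotProduct, conjTranspose_apply] using congrFun h2 (Sum.inr i)
    by_cases ha : (fun i => u (Sum.inl i)) = 0
    · refine ⟨fun i => (starRingEnd ℂ) (u (Sum.inr i)), -2 * (starRingEnd ℂ) μ, ?_, ?_, ?_⟩
      · intro hb
        apply hu
        funext x
        rcases x with i | i
        · exact congrFun ha i
        · simpa using congrFun hb i
      · funext i
        have h := congrArg (starRingEnd ℂ) (e2 i)
        simp only [map_neg, map_sum, map_mul, Complex.conj_conj, mul_assoc] at h
        rw [← Finset.mul_sum] at h
        simp only [mulVec, dotProduct, Pi.smul_apply, smul_eq_mul]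
        have h3 : (starRingEnd ℂ) (1/2 : ℂ) = 1/2 := by
          simp only [one_div, map_inv₀, map_ofNat]
        rw [h3] at h
        linear_combination (-2) * h
      · funext i
        have h := congrArg (starRingEnd ℂ) (k2 i)
        simpa [mulVec, dotProduct, conjTranspose_apply] using h
    · refine ⟨fun i => u (Sum.inl i), 2 * μ, ha, ?_, ?_⟩
      · funext i
        have h := e1 i
        simp only [mul_assoc] at h
        rw [← Finset.mul_sum] at h
        simp only [mulVec, dotProduct, Pi.smul_apply, smul_eq_mul]
        linear_combination 2 * h
      · funext i
        simpa [mulVec, dotProduct, conjTranspose_apply] using k1 i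
  · rintro ⟨u, μ, hu, h1, h2⟩
    refine ⟨Sum.elim u 0, μ / 2, ?_, ?_, ?_⟩
    · intro h
      apply hu
      funext i
      simpa using congrFun h (Sum.inl i)
    · rw [fromBlocks_mulVec]
      funext x
      rcases x with i | i
      · have h := congrFun h1 i
        simp only [Pi.smul_apply, smul_eq_mul] at h
        simp [smul_mulVec, Function.comp_def, h]
        ring
      · simp [Function.comp_def, ← Pi.zero_def]
    · rw [fromBlocks_conjTranspose, fromBlocks_mulVec]
      funext x
      rcases x with i | i
      · simpa [Function.comp_def] using congrFun h2 i
      · simp [Function.comp_def, ← Pi.zero_def]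
end

section
/- Let C_T be an L×L real matrix and C_Θ an L×K real matrix. Form the complex block matrices T = fromBlocks 0 (i•C_T) (-i•C_Tᵀ) 0 (of size 2L×2L) and Θ = fromBlocks 0 (i•C_Θ) (-i•C_Θ) 0 (of size 2L×2K), where the real matrices are coerced entrywise to ℂ. Then the Kalman space V(T,Θ) equals ℂ^{2L} if and only if both of the following hold: the ℂ-linear span of the columns of (C_T*C_Tᵀ)^k * C_Θ and of (C_T*C_Tᵀ)^k * C_T * C_Θ over all k ∈ ℕ is ℂ^L, and the ℂ-linear span of the columns of (C_Tᵀ*C_T)^k * C_Θ and of (C_Tᵀ*C_T)^k * C_Tᵀ * C_Θ over all k ∈ ℕ is ℂ^L. -/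
open Matrix

lemma kal_even {L K : ℕ} (A : Matrix (Fin L) (Fin L) ℂ) (B : Matrix (Fin L) (Fin K) ℂ) (k : ℕ) :
    (fromBlocks 0 (Complex.I • A) (-(Complex.I • Aᵀ)) 0) ^ (2 * k) *
        (fromBlocks 0 (Complex.I • B) (-(Complex.I • B)) 0) =
      fromBlocks 0 (Complex.I • ((A * Aᵀ) ^ k * B)) (-(Complex.I • ((Aᵀ * A) ^ k * B))) 0 := by
  have h2 : (fromBlocks 0 (Complex.I • A) (-(Complex.I • Aᵀ)) 0) ^ 2 =
      fromBlocks (A * Aᵀ) 0 0 (Aᵀ * A) := by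
    rw [pow_two, fromBlocks_multiply]
    simp [smul_smul]
  have hk : (fromBlocks (A * Aᵀ) 0 0 (Aᵀ * A)) ^ k =
      fromBlocks ((A * Aᵀ) ^ k) 0 0 ((Aᵀ * A) ^ k) := by
    induction k with
    | zero => simp
    | succ k ih => rw [pow_succ, ih, fromBlocks_multiply]; simp [pow_succ]
  rw [pow_mul, h2, hk, fromBlocks_multiply]
  simp

lemma kal_odd {L K : ℕ} (A : Matrix (Fin L) (Fin L) ℂ) (B : Matrix (Fin L) (Fin K) ℂ) (k : ℕ) :
    (fromBlocks 0 (Complex.I • A) (-(Complex.I • Aᵀ)) 0) ^ (2 * k + 1) *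
        (fromBlocks 0 (Complex.I • B) (-(Complex.I • B)) 0) =
      fromBlocks ((A * Aᵀ) ^ k * A * B) 0 0 ((Aᵀ * A) ^ k * Aᵀ * B) := by
  rw [pow_succ', Matrix.mul_assoc, kal_even, fromBlocks_multiply]
  have e1 : ∀ k : ℕ, A * (Aᵀ * A) ^ k = (A * Aᵀ) ^ k * A := by
    intro k
    induction k with
    | zero => simp
    | succ k ih => rw [pow_succ, ← Matrix.mul_assoc, ih, pow_succ]; simp only [Matrix.mul_assoc]
  have e2 : ∀ k : ℕ, Aᵀ * (A * Aᵀ) ^ k = (Aᵀ * A) ^ k * Aᵀ := by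
    intro k
    induction k with
    | zero => simp
    | succ k ih => rw [pow_succ, ← Matrix.mul_assoc, ih, pow_succ]; simp only [Matrix.mul_assoc]
  simp [smul_smul, ← Matrix.mul_assoc, e1, e2]

/-- Simplification of Kalman's criterion for systems that are real in the
creation/annihilation basis: with `T = fromBlocks 0 (i•C_T) (-i•C_Tᵀ) 0` and
`Θ = fromBlocks 0 (i•C_Θ) (-i•C_Θ) 0`, the Kalman space is everything iff the two real
span conditions hold. -/
theorem kalman_real_case_iff {L K : ℕ}
    (C_T : Matrix (Fin L) (Fin L) ℝ) (C_Θ : Matrix (Fin L) (Fin K) ℝ)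
    (CT : Matrix (Fin L) (Fin L) ℂ) (hCT : CT = C_T.map (fun x : ℝ => (x : ℂ)))
    (CΘ : Matrix (Fin L) (Fin K) ℂ) (hCΘ : CΘ = C_Θ.map (fun x : ℝ => (x : ℂ))) :
    kalmanSpace
        (fromBlocks 0 (Complex.I • CT) (-(Complex.I • CTᵀ)) 0)
        (fromBlocks 0 (Complex.I • CΘ) (-(Complex.I • CΘ)) 0) = ⊤ ↔
      (Submodule.span ℂ
          ({v | ∃ (k : ℕ) (x : Fin K → ℂ), v = ((CT * CTᵀ) ^ k * CΘ).mulVec x} ∪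
           {v | ∃ (k : ℕ) (x : Fin K → ℂ), v = ((CT * CTᵀ) ^ k * CT * CΘ).mulVec x}) = ⊤ ∧
       Submodule.span ℂ
          ({v | ∃ (k : ℕ) (x : Fin K → ℂ), v = ((CTᵀ * CT) ^ k * CΘ).mulVec x} ∪
           {v | ∃ (k : ℕ) (x : Fin K → ℂ), v = ((CTᵀ * CT) ^ k * CTᵀ * CΘ).mulVec x}) = ⊤) := by
  clear hCT hCΘ
  constructor
  · intro h
    constructor
    · rw [eq_top_iff]
      intro v _
      have hle : kalmanSpace
        (fromBlocks 0 (Complex.I • CT) (-(Complex.I • CTᵀ)) 0)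
        (fromBlocks 0 (Complex.I • CΘ) (-(Complex.I • CΘ)) 0) ≤ (Submodule.span ℂ
          ({v | ∃ (k : ℕ) (x : Fin K → ℂ), v = ((CT * CTᵀ) ^ k * CΘ).mulVec x} ∪
           {v | ∃ (k : ℕ) (x : Fin K → ℂ), v = ((CT * CTᵀ) ^ k * CT * CΘ).mulVec x})).comap
             (LinearMap.funLeft ℂ ℂ Sum.inl) := by
        refine Submodule.span_le.2 ?_
        rintro _ ⟨k, x, rfl⟩
        obtain ⟨j, rfl | rfl⟩ := Nat.even_or_odd' k
        · rw [kal_even, fromBlocks_mulVec]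
          refine Submodule.subset_span (Or.inl ⟨j, Complex.I • (x ∘ Sum.inr), ?_⟩)
          ext i
          simp [LinearMap.funLeft_apply, smul_mulVec, mulVec_smul]
        · rw [kal_odd, fromBlocks_mulVec]
          refine Submodule.subset_span (Or.inr ⟨j, x ∘ Sum.inl, ?_⟩)
          ext i
          simp [LinearMap.funLeft_apply]
      exact hle (x := Sum.elim v 0) (by rw [h]; exact Submodule.mem_top)
    · rw [eq_top_iff]
      intro v _
      have hle : kalmanSpace
        (fromBlocks 0 (Complex.I • CT) (-(Complex.I • CTᵀ)) 0)
        (fromBlocks 0 (Complex.I • CΘ) (-(Complex.I • CΘ)) 0) ≤ (Submodule.span ℂ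
          ({v | ∃ (k : ℕ) (x : Fin K → ℂ), v = ((CTᵀ * CT) ^ k * CΘ).mulVec x} ∪
           {v | ∃ (k : ℕ) (x : Fin K → ℂ), v = ((CTᵀ * CT) ^ k * CTᵀ * CΘ).mulVec x})).comap
             (LinearMap.funLeft ℂ ℂ Sum.inr) := by
        refine Submodule.span_le.2 ?_
        rintro _ ⟨k, x, rfl⟩
        obtain ⟨j, rfl | rfl⟩ := Nat.even_or_odd' k
        · rw [kal_even, fromBlocks_mulVec]
          refine Submodule.subset_span (Or.inl ⟨j, -(Complex.I • (x ∘ Sum.inl)), ?_⟩)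
          ext i
          simp [LinearMap.funLeft_apply, smul_mulVec, mulVec_smul, neg_mulVec, mulVec_neg]
        · rw [kal_odd, fromBlocks_mulVec]
          refine Submodule.subset_span (Or.inr ⟨j, x ∘ Sum.inr, ?_⟩)
          ext i
          simp [LinearMap.funLeft_apply]
      exact hle (x := Sum.elim 0 v) (by rw [h]; exact Submodule.mem_top)
  · rintro ⟨h1, h2⟩
    let e1 : (Fin L → ℂ) →ₗ[ℂ] (Fin L ⊕ Fin L → ℂ) :=
      { toFun := fun v => Sum.elim v 0
        map_add' := by intro a b; ext (i | i) <;> simp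
        map_smul' := by intro a b; ext (i | i) <;> simp }
    let e2 : (Fin L → ℂ) →ₗ[ℂ] (Fin L ⊕ Fin L → ℂ) :=
      { toFun := fun v => Sum.elim 0 v
        map_add' := by intro a b; ext (i | i) <;> simp
        map_smul' := by intro a b; ext (i | i) <;> simp }
    have l1 : ⊤ ≤ (kalmanSpace
        (fromBlocks 0 (Complex.I • CT) (-(Complex.I • CTᵀ)) 0)
        (fromBlocks 0 (Complex.I • CΘ) (-(Complex.I • CΘ)) 0)).comap e1 := by
      rw [← h1]
      refine Submodule.span_le.2 ?_
      rintro _ (⟨k, x, rfl⟩ | ⟨k, x, rfl⟩)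
      · refine Submodule.subset_span ⟨2 * k, Sum.elim 0 (-(Complex.I • x)), ?_⟩
        rw [kal_even, fromBlocks_mulVec]
        ext (i | i) <;> simp [e1, smul_mulVec, mulVec_smul, mulVec_neg, ← mul_assoc]
      · refine Submodule.subset_span ⟨2 * k + 1, Sum.elim x 0, ?_⟩
        rw [kal_odd, fromBlocks_mulVec]
        ext (i | i) <;> simp [e1]
    have l2 : ⊤ ≤ (kalmanSpace
        (fromBlocks 0 (Complex.I • CT) (-(Complex.I • CTᵀ)) 0)
        (fromBlocks 0 (Complex.I • CΘ) (-(Complex.I • CΘ)) 0)).comap e2 := by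
      rw [← h2]
      refine Submodule.span_le.2 ?_
      rintro _ (⟨k, x, rfl⟩ | ⟨k, x, rfl⟩)
      · refine Submodule.subset_span ⟨2 * k, Sum.elim (Complex.I • x) 0, ?_⟩
        rw [kal_even, fromBlocks_mulVec]
        ext (i | i) <;> simp [e2, smul_mulVec, mulVec_smul, neg_mulVec, ← mul_assoc]
      · refine Submodule.subset_span ⟨2 * k + 1, Sum.elim 0 x, ?_⟩
        rw [kal_odd, fromBlocks_mulVec]
        ext (i | i) <;> simp [e2]
    rw [eq_top_iff]
    intro v _
    have hv : v = e1 (v ∘ Sum.inl) + e2 (v ∘ Sum.inr) := by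
      ext (i | i) <;> simp [e1, e2]
    rw [hv]
    exact Submodule.add_mem _ (l1 Submodule.mem_top) (l2 Submodule.mem_top)
end

section
/- Let L ≥ 1 and let T = D + Dᵀ be the L×L complex tridiagonal matrix with ones on the sub- and super-diagonal and zeros elsewhere, where D is the upper shift matrix. Let e₀ be the first standard basis vector of ℂ^L. Then the ℂ-linear span of the vectors T^k.mulVec e₀ for 0 ≤ k ≤ L-1 is all of ℂ^L; in particular, the Kalman space V(T, Θ) equals ℂ^L when Θ is the L×1 matrix whose single column is e₀. -/
open Matrix

/-- Kalman's criterion for a fermionic chain with nearest-neighbour hopping interacting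
with a bath at its first site: the vectors `T^k e₀`, `0 ≤ k ≤ L-1`, span `ℂ^L`. -/
theorem chain_one_end_kalman {L : ℕ} (hL : 1 ≤ L)
    (D : Matrix (Fin L) (Fin L) ℂ)
    (hD : D = Matrix.of fun (i j : Fin L) => if (j : ℕ) = (i : ℕ) + 1 then (1 : ℂ) else 0)
    (T : Matrix (Fin L) (Fin L) ℂ) (hT : T = D + Dᵀ)
    (e₀ : Fin L → ℂ) (he₀ : e₀ = fun (i : Fin L) => if (i : ℕ) = 0 then (1 : ℂ) else 0)
    (Θ : Matrix (Fin L) (Fin 1) ℂ) (hΘ : Θ = Matrix.of fun i _ => e₀ i) :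
    Submodule.span ℂ {v | ∃ k ≤ L - 1, v = (T ^ k).mulVec e₀} = ⊤ ∧
      kalmanSpace T Θ = ⊤ := by
  have hsub : ∀ k, Submodule.map T.mulVecLin
      (Submodule.span ℂ {v | ∃ j ≤ k, v = (T ^ j).mulVec e₀}) ≤
      Submodule.span ℂ {v | ∃ j ≤ k + 1, v = (T ^ j).mulVec e₀} := by
    intro k
    rw [Submodule.map_span, Submodule.span_le]
    rintro _ ⟨_, ⟨j, hj, rfl⟩, rfl⟩
    refine Submodule.subset_span ⟨j + 1, by omega, ?_⟩
    rw [Matrix.mulVecLin_apply, Matrix.mulVec_mulVec, pow_succ']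
  have hmono : ∀ k l, k ≤ l → Submodule.span ℂ {v | ∃ j ≤ k, v = (T ^ j).mulVec e₀} ≤
      Submodule.span ℂ {v | ∃ j ≤ l, v = (T ^ j).mulVec e₀} := by
    intro k l hkl
    apply Submodule.span_mono
    rintro _ ⟨j, hj, rfl⟩
    exact ⟨j, by omega, rfl⟩
  have hTe : ∀ m : Fin L, T.mulVec (Pi.single m 1) = fun i : Fin L =>
      (if (m : ℕ) = i + 1 then (1 : ℂ) else 0) + if (i : ℕ) = m + 1 then 1 else 0 := by
    intro m
    ext i
    simp [hT, hD]
  have he : e₀ = Pi.single (⟨0, hL⟩ : Fin L) 1 := by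
    ext i
    simp [he₀, Pi.single_apply, Fin.ext_iff]
  have key : ∀ n (hn : n < L), (Pi.single (⟨n, hn⟩ : Fin L) (1 : ℂ) : Fin L → ℂ) ∈
      Submodule.span ℂ {v | ∃ j ≤ n, v = (T ^ j).mulVec e₀} := by
    intro n
    induction n using Nat.strong_induction_on with
    | _ n ih =>
      intro hn
      match n, ih, hn with
      | 0, _, hn =>
        exact Submodule.subset_span ⟨0, le_rfl, by rw [pow_zero, Matrix.one_mulVec, he]⟩
      | 1, ih, hn =>
        have h0 := hsub 0 (Submodule.mem_map_of_mem (ih 0 (by omega) (by omega)))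
        rw [Matrix.mulVecLin_apply, hTe] at h0
        convert h0 using 1
        ext i
        simp [Pi.single_apply, Fin.ext_iff]
      | n + 2, ih, hn =>
        have h1 := hsub (n + 1)
          (Submodule.mem_map_of_mem (ih (n + 1) (by omega) (by omega)))
        have h0 := hmono n (n + 2) (by omega) (ih n (by omega) (by omega))
        rw [Matrix.mulVecLin_apply, hTe] at h1
        convert Submodule.sub_mem _ h1 h0 using 1
        ext i
        simp only [Pi.single_apply, Fin.ext_iff, Pi.sub_apply]
        split_ifs <;> first | omega | simp
  have main : Submodule.span ℂ {v | ∃ k ≤ L - 1, v = (T ^ k).mulVec e₀} = ⊤ := by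
    rw [eq_top_iff]
    intro v _
    rw [pi_eq_sum_univ' v]
    refine Submodule.sum_mem _ fun i _ => Submodule.smul_mem _ _ ?_
    have h := hmono i (L - 1) (by omega) (key i i.2)
    convert h using 1
  refine ⟨main, ?_⟩
  rw [eq_top_iff, ← main]
  apply Submodule.span_mono
  rintro _ ⟨k, _, rfl⟩
  refine ⟨k, fun _ => 1, ?_⟩
  rw [← Matrix.mulVec_mulVec]
  congr 1
  ext i
  simp [hΘ, Matrix.mulVec, dotProduct]
end

section
/- Let L ≥ 3 and let T be the L×L complex 'star' matrix defined by T i j = 1 if exactly one of i, j equals 0, and T i j = 0 otherwise. Let e₀ be the first standard basis vector and w the vector with w 0 = 0 and w i = 1 for i ≠ 0. Then: (a) the ℂ-linear span of {T^k.mulVec e₀ : k ∈ ℕ} equals the span of {e₀, w}, which is a 2-dimensional proper subspace of ℂ^L, so Kalman's criterion fails; (b) the vector v with v 0 = √(L-1) and v i = 1 for i ≠ 0 satisfies T.mulVec v = √(L-1) • v; (c) every eigenvector u of T with u 0 = 0 satisfies T.mulVec u = 0; consequently any two eigenvectors of T whose first coordinate vanishes have the same eigenvalue (namely 0). -/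
open Matrix

/-- The star-shaped system: site `0` is coupled to every other site and to the bath.
(a) The Kalman space of `(T, e₀)` is the 2-dimensional proper subspace spanned by `e₀`
and `w`, so Kalman's criterion fails; (b) `v = (√(L-1), 1, …, 1)` is an eigenvector of `T`
for the eigenvalue `√(L-1)`; (c) every eigenvector of `T` with vanishing first coordinate
has eigenvalue `0`. -/
theorem star_system {L : ℕ} (hL : 3 ≤ L)
    (z0 : Fin L) (hz0 : z0 = ⟨0, by omega⟩)
    (T : Matrix (Fin L) (Fin L) ℂ)
    (hT : T = Matrix.of fun (i j : Fin L) =>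
      if (i = z0 ∧ j ≠ z0) ∨ (i ≠ z0 ∧ j = z0) then (1 : ℂ) else 0)
    (e₀ : Fin L → ℂ) (he₀ : e₀ = fun i => if i = z0 then (1 : ℂ) else 0)
    (w : Fin L → ℂ) (hw : w = fun i => if i = z0 then (0 : ℂ) else 1)
    (v : Fin L → ℂ)
    (hv : v = fun i => if i = z0 then (Real.sqrt ((L : ℝ) - 1) : ℂ) else 1) :
    (Submodule.span ℂ {x | ∃ k : ℕ, x = (T ^ k).mulVec e₀} =
        Submodule.span ℂ {e₀, w} ∧
      Module.finrank ℂ (Submodule.span ℂ ({e₀, w} : Set (Fin L → ℂ))) = 2 ∧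
      Submodule.span ℂ ({e₀, w} : Set (Fin L → ℂ)) ≠ ⊤) ∧
    T.mulVec v = (Real.sqrt ((L : ℝ) - 1) : ℂ) • v ∧
    (∀ (u : Fin L → ℂ) (lam : ℂ), u ≠ 0 → T.mulVec u = lam • u → u z0 = 0 →
      T.mulVec u = 0 ∧ lam = 0) := by
  have hmul : ∀ u : Fin L → ℂ, T.mulVec u =
      fun i => if i = z0 then (∑ j, u j) - u z0 else u z0 := by
    intro u
    funext i
    simp only [hT, Matrix.mulVec, dotProduct, Matrix.of_apply]
    by_cases hi : i = z0
    · have h1 : ∀ j, (if (i = z0 ∧ j ≠ z0) ∨ (i ≠ z0 ∧ j = z0) then (1 : ℂ) else 0) * u j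
          = u j - (if j = z0 then u j else 0) := by
        intro j
        by_cases hj : j = z0 <;> simp [hi, hj]
      rw [Finset.sum_congr rfl (fun j _ => h1 j), Finset.sum_sub_distrib]
      simp [hi]
    · simp [hi]
  have hone : ∑ j : Fin L, w j = (L : ℂ) - 1 := by
    have h1 : ∀ j, w j = 1 - (if j = z0 then (1 : ℂ) else 0) := by
      intro j
      by_cases hj : j = z0 <;> simp [hw, hj]
    rw [Finset.sum_congr rfl (fun j _ => h1 j), Finset.sum_sub_distrib]
    simp
  have he0 : T.mulVec e₀ = w := by
    rw [hmul]
    funext i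
    simp [he₀, hw]
  have hw0 : w z0 = 0 := by simp [hw]
  have hTw : T.mulVec w = ((L : ℂ) - 1) • e₀ := by
    rw [hmul, hone, hw0]
    funext i
    simp [he₀]
  have hvd : v = (Real.sqrt ((L : ℝ) - 1) : ℂ) • e₀ + w := by
    funext i
    by_cases hi : i = z0 <;> simp [hv, he₀, hw, hi]
  have hsq : (Real.sqrt ((L : ℝ) - 1) : ℂ) * (Real.sqrt ((L : ℝ) - 1) : ℂ) = (L : ℂ) - 1 := by
    have hL' : (3 : ℝ) ≤ L := by exact_mod_cast hL
    rw [← Complex.ofReal_mul, Real.mul_self_sqrt (by linarith)]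
    push_cast
    rfl
  have hz1 : (⟨1, by omega⟩ : Fin L) ≠ z0 := by simp [hz0]
  have hz2 : (⟨2, by omega⟩ : Fin L) ≠ z0 := by simp [hz0]
  refine ⟨⟨?_, ?_, ?_⟩, ?_, ?_⟩
  · apply le_antisymm
    · rw [Submodule.span_le]
      rintro x ⟨k, rfl⟩
      induction k with
      | zero =>
        simp only [pow_zero, Matrix.one_mulVec]
        exact Submodule.subset_span (by simp)
      | succ k ih =>
        obtain ⟨a, b, hab⟩ := Submodule.mem_span_pair.1 ih
        rw [pow_succ', ← Matrix.mulVec_mulVec, ← hab, Matrix.mulVec_add, Matrix.mulVec_smul,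
          Matrix.mulVec_smul, he0, hTw]
        refine Submodule.mem_span_pair.2 ⟨b * ((L : ℂ) - 1), a, ?_⟩
        rw [smul_smul, add_comm]
    · rw [Submodule.span_le]
      rintro x (rfl | rfl)
      · exact Submodule.subset_span ⟨0, by simp⟩
      · exact Submodule.subset_span ⟨1, by simp [he0]⟩
  · have hli : LinearIndependent ℂ ![e₀, w] := by
      rw [LinearIndependent.pair_iff]
      intro s t h
      have ha := congrFun h z0
      have hb := congrFun h ⟨1, by omega⟩
      simp only [he₀, hw, Pi.add_apply, Pi.smul_apply] at ha hb
      simp only [hz1, if_false, if_true] at ha hb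
      simpa using And.intro ha hb
    have := finrank_span_eq_card hli
    rw [Matrix.range_cons_cons_empty] at this
    simpa using this
  · intro htop
    have hm : (fun i => if i = (⟨1, by omega⟩ : Fin L) then (1 : ℂ) else 0) ∈
        Submodule.span ℂ ({e₀, w} : Set (Fin L → ℂ)) := by
      rw [htop]; trivial
    obtain ⟨a, b, hab⟩ := Submodule.mem_span_pair.1 hm
    have h1 := congrFun hab ⟨1, by omega⟩
    have h2 := congrFun hab ⟨2, by omega⟩
    simp only [he₀, hw, Pi.add_apply, Pi.smul_apply, hz1, hz2, if_false] at h1 h2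
    simp at h1 h2
    rw [h1] at h2
    exact one_ne_zero h2
  · rw [hvd, Matrix.mulVec_add, Matrix.mulVec_smul, he0, hTw, smul_add, smul_smul, hsq, add_comm]
  · intro u lam hu hl hu0
    have hlam : lam = 0 := by
      by_contra hne
      apply hu
      funext i
      by_cases hi : i = z0
      · simp [hi, hu0]
      · have h := congrFun hl i
        rw [hmul] at h
        simp only [hi, if_false, hu0, Pi.smul_apply, smul_eq_mul] at h
        simpa [hne] using h.symm
    refine ⟨?_, hlam⟩
    rw [hl, hlam, zero_smul]
end

section
/- Let L ≥ 1, let h, κ ∈ ℝ with κ² ≠ 1 or h ≠ 0, and let θ₁, θ_L be nonzero reals. Let C_T = h•(identity) + ((1-κ)/2)•D + ((1+κ)/2)•Dᵀ be an L×L real matrix, and let C_Θ be the L×2 real matrix with C_Θ 0 0 = (1+κ)·θ₁/2, C_Θ (L-1) 1 = (1-κ)·θ_L/2 and all other entries 0. Then the ℝ-linear span of the columns of the matrices (C_T*C_Tᵀ)^k * C_Θ and (C_T*C_Tᵀ)^k * C_T * C_Θ over all k ∈ ℕ is all of ℝ^L, and the ℝ-linear span of the columns of (C_Tᵀ*C_T)^k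 * C_Θ and (C_Tᵀ*C_T)^k * C_Tᵀ * C_Θ over all k ∈ ℕ is all of ℝ^L. (These are exactly the two span conditions equivalent to Kalman's criterion for the block matrices T = fromBlocks 0 (i•C_T) (-i•C_Tᵀ) 0 and Θ = fromBlocks 0 (i•C_Θ) (-i•C_Θ) 0 arising from the Jordan–Wigner transform of the XY spin chain coupled to baths at both ends; hence the XY model has a unique stationary state when κ² ≠ 1 or h ≠ 0.) -/
open Matrix

/-- The span generated by one of the two Kalman families. -/
noncomputable def kalW {L : ℕ} (C : Matrix (Fin L) (Fin L) ℝ) (Q : Matrix (Fin L) (Fin 2) ℝ) :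
    Submodule ℝ (Fin L → ℝ) :=
  Submodule.span ℝ
        ({v | ∃ (k : ℕ) (x : Fin 2 → ℝ), v = ((C * Cᵀ) ^ k * Q).mulVec x} ∪
         {v | ∃ (k : ℕ) (x : Fin 2 → ℝ), v = ((C * Cᵀ) ^ k * C * Q).mulVec x})

lemma kal_pow {L : ℕ} (C B : Matrix (Fin L) (Fin L) ℝ) (k : ℕ) :
    C * (B * C) ^ k = (C * B) ^ k * C := by
  induction k with
  | zero => simp
  | succ k ih => rw [pow_succ, ← mul_assoc, ih, pow_succ]; simp only [mul_assoc]

lemma kal_map {L : ℕ} (C : Matrix (Fin L) (Fin L) ℝ) (Q : Matrix (Fin L) (Fin 2) ℝ)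
    (v : Fin L → ℝ) (hv : v ∈ kalW Cᵀ Q) : C *ᵥ v ∈ kalW C Q := by
  unfold kalW at hv
  induction hv using Submodule.span_induction with
  | mem v hv =>
    rw [transpose_transpose] at hv
    rcases hv with ⟨k, x, rfl⟩ | ⟨k, x, rfl⟩
    · refine Submodule.subset_span (Or.inr ⟨k, x, ?_⟩)
      rw [mulVec_mulVec, ← Matrix.mul_assoc, kal_pow]
    · refine Submodule.subset_span (Or.inl ⟨k + 1, x, ?_⟩)
      rw [mulVec_mulVec, ← Matrix.mul_assoc, ← Matrix.mul_assoc, kal_pow, pow_succ]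
      simp only [Matrix.mul_assoc]
  | zero => simp
  | add x y _ _ hx hy => rw [mulVec_add]; exact add_mem hx hy
  | smul a x _ hx => rw [mulVec_smul]; exact Submodule.smul_mem _ _ hx

lemma kal_Q {L : ℕ} (C : Matrix (Fin L) (Fin L) ℝ) (Q : Matrix (Fin L) (Fin 2) ℝ)
    (x : Fin 2 → ℝ) : Q *ᵥ x ∈ kalW C Q :=
  Submodule.subset_span (Or.inl ⟨0, x, by simp⟩)

lemma kal_solve {E : Type*} [AddCommGroup E] [Module ℝ E] (V : Submodule ℝ E)
    {x y z w : E} {h b a : ℝ} (hb : b ≠ 0) (hw : w ∈ V) (e : w = h • x + b • y + a • z)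
    (hx : h • x ∈ V) (hz : a • z ∈ V) : y ∈ V := by
  have : b • y ∈ V := by
    have e2 : b • y = w - h • x - a • z := by rw [e]; abel
    rw [e2]; exact sub_mem (sub_mem hw hx) hz
  exact (Submodule.smul_mem_iff V hb).1 this

lemma kal_chain {L : ℕ} (C B : Matrix (Fin L) (Fin L) ℝ) (V W : Submodule ℝ (Fin L → ℝ))
    (hC : ∀ v ∈ W, C *ᵥ v ∈ V) (hB : ∀ v ∈ V, B *ᵥ v ∈ W)
    (h a b : ℝ) (hb : b ≠ 0) (hah : a ≠ 0 ∨ h ≠ 0) (f g : ℕ → Fin L → ℝ)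
    (g0 : g 0 = 0) (g1 : ∀ j, g (j + 1) = f j)
    (rC : ∀ j < L, C *ᵥ f j = h • f j + b • f (j + 1) + a • g j)
    (rB : ∀ j < L, B *ᵥ f j = h • f j + a • f (j + 1) + b • g j)
    (hV : f 0 ∈ V) (hW : f 0 ∈ W) :
    ∀ j < L, (f j ∈ V ∧ f j ∈ W) ∧ (g j ∈ V ∧ g j ∈ W) := by
  intro j
  induction j with
  | zero => intro _; rw [g0]; exact ⟨⟨hV, hW⟩, zero_mem _, zero_mem _⟩
  | succ j ih =>
    intro hj
    obtain ⟨⟨f1, f2⟩, g3, g4⟩ := ih (by omega)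
    rw [g1]
    refine ⟨?_, f1, f2⟩
    have hv : f (j + 1) ∈ V := kal_solve V hb (hC _ f2) (rC j (by omega))
      (V.smul_mem _ f1) (V.smul_mem _ g3)
    refine ⟨hv, ?_⟩
    by_cases ha : a = 0
    · have hh : h ≠ 0 := by tauto
      have e := rB (j + 1) hj
      rw [g1] at e
      refine kal_solve W (h := a) (x := f (j + 1 + 1)) (a := b) (z := f j) hh (hB _ hv) ?_ ?_ ?_
      · rw [e]; abel
      · rw [ha, zero_smul]; exact zero_mem _
      · exact W.smul_mem _ f2
    · exact kal_solve W ha (hB _ f1) (rB j (by omega)) (W.smul_mem _ f2) (W.smul_mem _ g4)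

lemma kal_top {L : ℕ} (V : Submodule ℝ (Fin L → ℝ))
    (hV : ∀ i : Fin L, Pi.single i (1 : ℝ) ∈ V) : V = ⊤ := by
  rw [eq_top_iff]
  intro v _
  rw [pi_eq_sum_univ' v]
  refine sum_mem fun i _ => V.smul_mem _ ?_
  convert hV i using 1



/-- Kalman's criterion (in its real form) for the XY spin chain with anisotropy `κ` and
magnetic field `h`, coupled with nonzero strengths `θ₁`, `θ_L` to one bath spin at each
end: when `κ² ≠ 1` or `h ≠ 0`, both real span conditions hold, hence the XY model has a
unique stationary state. -/
theorem xy_chain_kalman {L : ℕ} (hL : 1 ≤ L)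
    (h κ θ₁ θL : ℝ) (hκh : κ ^ 2 ≠ 1 ∨ h ≠ 0) (hθ₁ : θ₁ ≠ 0) (hθL : θL ≠ 0)
    (D : Matrix (Fin L) (Fin L) ℝ)
    (hD : D = Matrix.of fun (i j : Fin L) => if (j : ℕ) = (i : ℕ) + 1 then (1 : ℝ) else 0)
    (C_T : Matrix (Fin L) (Fin L) ℝ)
    (hCT : C_T = h • (1 : Matrix (Fin L) (Fin L) ℝ) + ((1 - κ)/2) • D + ((1 + κ)/2) • Dᵀ)
    (C_Θ : Matrix (Fin L) (Fin 2) ℝ)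
    (hCΘ : C_Θ = Matrix.of fun (i : Fin L) (k : Fin 2) =>
      if (i : ℕ) = 0 ∧ (k : ℕ) = 0 then (1 + κ) * θ₁ / 2
      else if (i : ℕ) = L - 1 ∧ (k : ℕ) = 1 then (1 - κ) * θL / 2 else 0) :
    Submodule.span ℝ
        ({v | ∃ (k : ℕ) (x : Fin 2 → ℝ), v = ((C_T * C_Tᵀ) ^ k * C_Θ).mulVec x} ∪
         {v | ∃ (k : ℕ) (x : Fin 2 → ℝ), v = ((C_T * C_Tᵀ) ^ k * C_T * C_Θ).mulVec x}) = ⊤ ∧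
    Submodule.span ℝ
        ({v | ∃ (k : ℕ) (x : Fin 2 → ℝ), v = ((C_Tᵀ * C_T) ^ k * C_Θ).mulVec x} ∪
         {v | ∃ (k : ℕ) (x : Fin 2 → ℝ), v = ((C_Tᵀ * C_T) ^ k * C_Tᵀ * C_Θ).mulVec x}) = ⊤ := by
  have key : kalW C_T C_Θ = ⊤ ∧ kalW C_Tᵀ C_Θ = ⊤ := by
    have hC := kal_map C_T C_Θ
    have hB := kal_map C_Tᵀ C_Θ
    rw [transpose_transpose] at hB
    have entry : ∀ i j : Fin L, C_T i j = h * (if (i : ℕ) = j then 1 else 0)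
        + (1 - κ) / 2 * (if (j : ℕ) = i + 1 then 1 else 0)
        + (1 + κ) / 2 * (if (i : ℕ) = j + 1 then 1 else 0) := by
      intro i j
      simp [hCT, hD, Matrix.one_apply, Fin.ext_iff]
    by_cases hb : (1 + κ) / 2 = 0
    · have ha : (1 - κ) / 2 ≠ 0 := by intro h'; linarith
      have hh : h ≠ 0 := by
        rcases hκh with h1 | h1
        · exact absurd (by have : κ = -1 := by linarith
                           rw [this]; norm_num) h1
        · exact h1
      let f : ℕ → Fin L → ℝ := fun j i => if (i : ℕ) + j + 1 = L then 1 else 0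
      let g : ℕ → Fin L → ℝ := fun j i => if (i : ℕ) + j = L then 1 else 0
      have fs : ∀ j (hj : j < L), f j = Pi.single (⟨L - 1 - j, by omega⟩ : Fin L) (1 : ℝ) := by
        intro j hj
        ext i
        simp only [f, Pi.single_apply, Fin.ext_iff]
        congr 1
        apply propext
        omega
      have f0 : ∀ C, f 0 ∈ kalW C C_Θ := by
        intro C
        have := kal_Q C C_Θ (Pi.single 1 ((1 - κ) / 2 * θL)⁻¹)
        convert this using 1
        ext i
        have hn : (1 - κ) / 2 * θL ≠ 0 := mul_ne_zero ha hθL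
        have hn' : (1 - κ) * θL / 2 = (1 - κ) / 2 * θL := by ring
        have hi : ((i : ℕ) + 1 = L) ↔ (i : ℕ) = L - 1 := by omega
        simp only [f, hCΘ, add_zero, hi, mulVec_single, Matrix.col_apply, Matrix.of_apply, hn',
          Pi.smul_apply, MulOpposite.smul_eq_mul_unop, MulOpposite.unop_op]
        generalize (1 - κ) / 2 * θL = c at hn
        by_cases hi2 : (i : ℕ) = L - 1 <;> simp [hi2, hn]
      have main := kal_chain C_T C_Tᵀ _ _ hC hB h ((1 + κ) / 2) ((1 - κ) / 2) ha (Or.inr hh) f g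
        (by ext i; have := i.2; simp [g]; omega) (by intro j; rfl)
        (by
          intro j hj
          rw [fs j hj, mulVec_single_one, ← fs j hj]
          ext i
          simp only [f, g, col_apply, entry, Pi.add_apply, Pi.smul_apply, smul_eq_mul]
          congr 1
          · congr 1
            · congr 2; apply propext; omega
            · congr 2; apply propext; omega
          · congr 2; apply propext; omega)
        (by
          intro j hj
          rw [fs j hj, mulVec_single_one, ← fs j hj]
          ext i
          simp only [f, g, col_apply, transpose_apply, entry, Pi.add_apply, Pi.smul_apply,
            smul_eq_mul]
          rw [add_right_comm]
          congr 1
          · congr 1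
            · congr 2; apply propext; omega
            · congr 2; apply propext; omega
          · congr 2; apply propext; omega)
        (f0 _) (f0 _)
      have e : ∀ i : Fin L, Pi.single i (1 : ℝ) = f (L - 1 - i) := by
        intro i
        rw [fs _ (by omega)]
        congr 1
        ext
        simp only
        omega
      constructor
      · exact kal_top _ fun i => by rw [e]; exact (main _ (by omega)).1.1
      · exact kal_top _ fun i => by rw [e]; exact (main _ (by omega)).1.2
    · have hah : (1 - κ) / 2 ≠ 0 ∨ h ≠ 0 := by
        rcases hκh with h1 | h1
        · left
          intro h'
          exact h1 (by have : κ = 1 := by linarith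
                       rw [this]; norm_num)
        · exact Or.inr h1
      let f : ℕ → Fin L → ℝ := fun j i => if (i : ℕ) = j then 1 else 0
      let g : ℕ → Fin L → ℝ := fun j i => if (i : ℕ) + 1 = j then 1 else 0
      have fs : ∀ j (hj : j < L), f j = Pi.single (⟨j, hj⟩ : Fin L) (1 : ℝ) := by
        intro j hj
        ext i
        simp only [f, Pi.single_apply, Fin.ext_iff]
      have f0 : ∀ C, f 0 ∈ kalW C C_Θ := by
        intro C
        have := kal_Q C C_Θ (Pi.single 0 ((1 + κ) / 2 * θ₁)⁻¹)
        convert this using 1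
        ext i
        have hn : (1 + κ) / 2 * θ₁ ≠ 0 := mul_ne_zero hb hθ₁
        have hn' : (1 + κ) * θ₁ / 2 = (1 + κ) / 2 * θ₁ := by ring
        simp only [f, hCΘ, mulVec_single, Matrix.col_apply, Matrix.of_apply, hn',
          Pi.smul_apply, MulOpposite.smul_eq_mul_unop, MulOpposite.unop_op]
        generalize (1 + κ) / 2 * θ₁ = c at hn
        by_cases hi2 : (i : ℕ) = 0 <;> simp [hi2, hn]
      have main := kal_chain C_T C_Tᵀ _ _ hC hB h ((1 - κ) / 2) ((1 + κ) / 2) hb hah f g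
        (by ext i; simp [g]) (by intro j; ext i; simp [f, g])
        (by
          intro j hj
          rw [fs j hj, mulVec_single_one, ← fs j hj]
          ext i
          simp only [f, g, col_apply, entry, Pi.add_apply, Pi.smul_apply, smul_eq_mul]
          rw [add_right_comm]
          congr 1
          congr 2
          apply propext
          omega)
        (by
          intro j hj
          rw [fs j hj, mulVec_single_one, ← fs j hj]
          ext i
          simp only [f, g, col_apply, transpose_apply, entry, Pi.add_apply, Pi.smul_apply,
            smul_eq_mul]
          congr 1
          · congr 1
            congr 2; apply propext; omega
          · congr 2; apply propext; omega)
        (f0 _) (f0 _)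
      constructor
      · exact kal_top _ fun i => by rw [← fs i i.2]; exact (main _ i.2).1.1
      · exact kal_top _ fun i => by rw [← fs i i.2]; exact (main _ i.2).1.2
  simpa only [kalW, transpose_transpose] using key
end
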